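/- Let T₁, …, T_k be pairwise commuting computable measure-preserving transformations of Cantor space {0,1}^ℕ with the uniform measure λ, and let P ⊆ {0,1}^ℕ be a Π⁰₁ class such that λ(P) > 0 and λ(P) is a computable real. If z ∈ P is Schnorr random, then there is n ≥ 1 such that z ∈ ⋂_{1≤i≤k} T_i^{-n}(P). -/

import Mathlib

open MeasureTheory

/-- `σ` is a prefix of the infinite binary sequence `Z`. -/
def IsPrefixOf (σ : List Bool) (Z : ℕ → Bool) : Prop :=
  ∀ i : ℕ, i < σ.length → σ.getD i false = Z i

/-- The open subset `⟦S⟧` of Cantor space generated by a set of finite binary strings. -/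
def openCl (S : Set (List Bool)) : Set (ℕ → Bool) :=
  {Z | ∃ σ ∈ S, IsPrefixOf σ Z}

/-- A set of finite binary strings is computably enumerable. -/
def CEStrings (S : Set (List Bool)) : Prop :=
  ∃ f : ℕ → Option (List Bool), Computable f ∧ S = {σ | ∃ n, f n = some σ}

/-- `P` is a Π⁰₁ class: the complement of the open set generated by a c.e. set of strings. -/
def Pi01Class (P : Set (ℕ → Bool)) : Prop :=
  ∃ S : Set (List Bool), CEStrings S ∧ P = (openCl S)ᶜ

/-- The shift operator `T` on Cantor space: `T Z n = Z (n+1)`. -/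
def shift (Z : ℕ → Bool) : ℕ → Bool := fun n => Z (n + 1)

/-- `Z` is `k`-recurrent in `P`: for some `n ≥ 1`, `T^{n i} Z ∈ P` for all `1 ≤ i ≤ k`. -/
def KRecurrentIn (k : ℕ) (P : Set (ℕ → Bool)) (Z : ℕ → Bool) : Prop :=
  ∃ n : ℕ, 1 ≤ n ∧ ∀ i : ℕ, 1 ≤ i → i ≤ k → shift^[n * i] Z ∈ P

/-- `Z` is multiply recurrent in `P`: `k`-recurrent in `P` for every `k ≥ 1`. -/
def MultiplyRecurrentIn (P : Set (ℕ → Bool)) (Z : ℕ → Bool) : Prop :=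
  ∀ k : ℕ, 1 ≤ k → KRecurrentIn k P Z

/-- `μ` is the uniform (fair-coin) product measure on Cantor space:
each basic cylinder determined by a string `σ` has measure `2^{-|σ|}`. -/
def IsUniformMeasure (μ : Measure (ℕ → Bool)) : Prop :=
  ∀ σ : List Bool, μ {Z | IsPrefixOf σ Z} = 2⁻¹ ^ σ.length

/-- A uniformly computably enumerable sequence of sets of strings. -/
def UniformlyCE (S : ℕ → Set (List Bool)) : Prop :=
  ∃ f : ℕ → ℕ → Option (List Bool), Computable₂ f ∧
    ∀ m, S m = {σ | ∃ n, f m n = some σ}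

/-- A Martin-Löf test with respect to the measure `μ`. -/
def MLTest (μ : Measure (ℕ → Bool)) (S : ℕ → Set (List Bool)) : Prop :=
  UniformlyCE S ∧ ∀ m, μ (openCl (S m)) ≤ 2⁻¹ ^ m

/-- `Z` is Martin-Löf random w.r.t. `μ`. -/
def MLRandom (μ : Measure (ℕ → Bool)) (Z : ℕ → Bool) : Prop :=
  ∀ S : ℕ → Set (List Bool), MLTest μ S → ∃ m, Z ∉ openCl (S m)

/-- A real is computable if some computable sequence of rationals approximates it
within `2^{-j}`. -/
def ComputableReal (x : ℝ) : Prop :=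
  ∃ q : ℕ → ℚ, Computable q ∧ ∀ j : ℕ, |x - (q j : ℝ)| ≤ 2⁻¹ ^ j

/-- A Schnorr test w.r.t. `μ`: a Martin-Löf test whose levels have uniformly
computable measures. -/
def SchnorrTest (μ : Measure (ℕ → Bool)) (S : ℕ → Set (List Bool)) : Prop :=
  UniformlyCE S ∧ (∀ m, μ (openCl (S m)) ≤ 2⁻¹ ^ m) ∧
    ∃ q : ℕ → ℕ → ℚ, Computable₂ q ∧
      ∀ m j : ℕ, |(μ (openCl (S m))).toReal - (q m j : ℝ)| ≤ 2⁻¹ ^ j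

/-- `Z` is Schnorr random w.r.t. `μ`. -/
def SchnorrRandom (μ : Measure (ℕ → Bool)) (Z : ℕ → Bool) : Prop :=
  ∀ S : ℕ → Set (List Bool), SchnorrTest μ S → ∃ m, Z ∉ openCl (S m)

/-- `Z` is weakly (Kurtz) random w.r.t. `μ`: it belongs to no Π⁰₁ class of measure `0`. -/
def KurtzRandom (μ : Measure (ℕ → Bool)) (Z : ℕ → Bool) : Prop :=
  ∀ P : Set (ℕ → Bool), Pi01Class P → μ P = 0 → Z ∉ P
/-- The length-`n` prefix of `Z`, as a finite binary string. -/
def prefixList (Z : ℕ → Bool) (n : ℕ) : List Bool := List.ofFn (fun i : Fin n => Z i)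

/-- `T` is a computable map on Cantor space: there is an algorithm (a computable monotone
string function) that, given any desired output prefix length `m`, computes the first `m`
bits of `T Z` from finitely many bits of `Z`. -/
def ComputableMap (T : (ℕ → Bool) → (ℕ → Bool)) : Prop :=
  ∃ f : List Bool → List Bool, Computable f ∧
    (∀ σ τ : List Bool, σ <+: τ → f σ <+: f τ) ∧
    ∀ Z : ℕ → Bool, ∀ m : ℕ, ∃ n : ℕ,
      m ≤ (f (prefixList Z n)).length ∧ IsPrefixOf (f (prefixList Z n)) (T Z)

/-- A generalized Martin-Löf test w.r.t. `μ`: uniformly c.e. open sets whose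
intersection is null. -/
def GeneralizedMLTest (μ : MeasureTheory.Measure (ℕ → Bool)) (S : ℕ → Set (List Bool)) : Prop :=
  UniformlyCE S ∧ μ (⋂ m, openCl (S m)) = 0

/-- `Z` is weakly 2-random w.r.t. `μ`. -/
def Weak2Random (μ : MeasureTheory.Measure (ℕ → Bool)) (Z : ℕ → Bool) : Prop :=
  ∀ S : ℕ → Set (List Bool), GeneralizedMLTest μ S → ∃ m, Z ∉ openCl (S m)

/-- The average of a real function over a finite type. -/
noncomputable def av {X : Type*} (f : X → ℝ) : ℝ := (∑ᶠ x, f x) / Nat.card X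

/-- The density of a subset of a finite type. -/
noncomputable def dens {X : Type*} (A : Set X) : ℝ := av (A.indicator 1)

theorem av_eq_sum {X : Type*} [Fintype X] (f : X → ℝ) : av f = (∑ x, f x) / Fintype.card X := by
  rw [av, finsum_eq_sum_of_fintype, Nat.card_eq_fintype_card]

theorem indicator_one_le {X : Type*} (A : Set X) (x : X) : A.indicator (1 : X → ℝ) x ≤ 1 :=
  Set.indicator_le_self' (fun _ _ => zero_le_one) x

section Average

variable {X Y : Type*} [Finite X] [Finite Y]

theorem av_mono {f g : X → ℝ} (h : ∀ x, f x ≤ g x) : av f ≤ av g := by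
  have := Fintype.ofFinite X
  rw [av_eq_sum, av_eq_sum]
  gcongr with x
  exact h x

theorem av_add (f g : X → ℝ) : av (fun x => f x + g x) = av f + av g := by
  have := Fintype.ofFinite X
  simp only [av_eq_sum, Finset.sum_add_distrib, add_div]

theorem av_sub (f g : X → ℝ) : av (fun x => f x - g x) = av f - av g := by
  have := Fintype.ofFinite X
  simp only [av_eq_sum, Finset.sum_sub_distrib, sub_div]

theorem av_const_mul (c : ℝ) (f : X → ℝ) : av (fun x => c * f x) = c * av f := by
  have := Fintype.ofFinite X
  simp only [av_eq_sum, ← Finset.mul_sum, mul_div_assoc]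

theorem av_sum {J : Type*} (s : Finset J) (f : J → X → ℝ) :
    av (fun x => ∑ j ∈ s, f j x) = ∑ j ∈ s, av (f j) := by
  have := Fintype.ofFinite X
  simp only [av_eq_sum, Finset.sum_div]
  rw [Finset.sum_comm]

theorem av_const [Nonempty X] (c : ℝ) : av (fun _ : X => c) = c := by
  have := Fintype.ofFinite X
  rw [av_eq_sum]
  simp

theorem av_le_of_le [Nonempty X] {f : X → ℝ} {c : ℝ} (h : ∀ x, f x ≤ c) : av f ≤ c :=
  (av_mono h).trans_eq (av_const c)

theorem le_av_of_le [Nonempty X] {f : X → ℝ} {c : ℝ} (h : ∀ x, c ≤ f x) : c ≤ av f :=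
  (av_const c).symm.trans_le (av_mono h)

theorem av_nonneg {f : X → ℝ} (h : ∀ x, 0 ≤ f x) : 0 ≤ av f := by
  have := Fintype.ofFinite X
  rw [av_eq_sum]
  exact div_nonneg (Finset.sum_nonneg fun x _ => h x) (Nat.cast_nonneg _)

theorem av_equiv (e : X ≃ Y) (f : Y → ℝ) : av (fun x => f (e x)) = av f := by
  have := Fintype.ofFinite X
  have := Fintype.ofFinite Y
  rw [av_eq_sum, av_eq_sum, Equiv.sum_comp e f, Fintype.card_congr e]

theorem av_prod (f : X × Y → ℝ) : av f = av fun x => av fun y => f (x, y) := by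
  have := Fintype.ofFinite X
  have := Fintype.ofFinite Y
  simp only [av_eq_sum, Fintype.sum_prod_type, Fintype.card_prod, Nat.cast_mul, ← Finset.sum_div]
  rw [div_div, mul_comm]

theorem av_comm (f : X → Y → ℝ) : (av fun x => av fun y => f x y) = av fun y => av fun x => f x y := by
  rw [← av_prod (fun p : X × Y => f p.1 p.2), ← av_prod (fun p : Y × X => f p.2 p.1),
    ← av_equiv (Equiv.prodComm Y X)]
  rfl

theorem le_av_single [Nonempty X] {f : X → ℝ} (h : ∀ x, 0 ≤ f x) (x : X) :
    f x / Nat.card X ≤ av f := by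
  have := Fintype.ofFinite X
  rw [av_eq_sum, Nat.card_eq_fintype_card]
  gcongr
  exact Finset.single_le_sum (fun x _ => h x) (Finset.mem_univ x)

theorem dens_nonneg (A : Set X) : 0 ≤ dens A :=
  av_nonneg fun _ => Set.indicator_nonneg (fun _ _ => zero_le_one) _

theorem dens_le_one (A : Set X) : dens A ≤ 1 := by
  rcases isEmpty_or_nonempty X with h | h
  · have := Fintype.ofFinite X
    simp [dens, av_eq_sum]
  · exact av_le_of_le (indicator_one_le A)

theorem dens_mono {A B : Set X} (h : A ⊆ B) : dens A ≤ dens B :=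
  av_mono fun x => Set.indicator_le_indicator_of_subset h (fun _ => zero_le_one) x

theorem nonempty_of_dens_pos {A : Set X} (h : 0 < dens A) : A.Nonempty := by
  by_contra hA
  rw [Set.not_nonempty_iff_eq_empty] at hA
  have := Fintype.ofFinite X
  simp [hA, dens, av_eq_sum] at h

/-- If a function bounded by `1` has average at least `d`, then it exceeds `d / 2` on a set of
density at least `d / 2`. -/
theorem half_le_dens [Nonempty X] {f : X → ℝ} {d : ℝ} (hd : 0 ≤ d) (hf : ∀ x, f x ≤ 1)
    (h : d ≤ av f) : d / 2 ≤ dens {x | d / 2 ≤ f x} := by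
  have : av f ≤ av fun x => d / 2 + ({x | d / 2 ≤ f x} : Set X).indicator 1 x := by
    refine av_mono fun x => ?_
    by_cases hx : d / 2 ≤ f x
    · rw [Set.indicator_of_mem (by exact hx)]
      have := hf x
      simp only [Pi.one_apply]
      linarith
    · rw [Set.indicator_of_notMem (by exact hx)]
      push Not at hx
      linarith
  rw [av_add, av_const] at this
  rw [dens]
  linarith

/-- Pigeonhole principle for densities. -/
theorem exists_dens_ge {J : Type*} [Finite J] {P : J → X → Prop} {d : ℝ} (hd : 0 < d)
    (h : d ≤ dens {x | ∃ j, P j x}) : ∃ j, d / Nat.card J ≤ dens {x | P j x} := by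
  have := Fintype.ofFinite J
  obtain ⟨x, j, -⟩ := nonempty_of_dens_pos (hd.trans_le h)
  have : Nonempty J := ⟨j⟩
  by_contra! hc
  have h1 : dens {x | ∃ j, P j x} ≤ av fun x => ∑ j, ({x | P j x} : Set X).indicator 1 x := by
    refine av_mono fun x => ?_
    have hnn : ∀ j ∈ Finset.univ, 0 ≤ ({x | P j x} : Set X).indicator (1 : X → ℝ) x :=
      fun j _ => Set.indicator_nonneg (fun _ _ => zero_le_one) _
    by_cases hx : ∃ j, P j x
    · obtain ⟨j, hj⟩ := hx
      rw [Set.indicator_of_mem (by exact ⟨j, hj⟩)]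
      refine le_trans ?_ (Finset.single_le_sum hnn (Finset.mem_univ j))
      rw [Set.indicator_of_mem (by exact hj)]
    · rw [Set.indicator_of_notMem (by exact hx)]
      exact Finset.sum_nonneg hnn
  rw [av_sum] at h1
  have h2 : ∑ j, av (({x | P j x} : Set X).indicator 1) < ∑ _j : J, d / Nat.card J :=
    Finset.sum_lt_sum_of_nonempty Finset.univ_nonempty fun j _ => hc j
  rw [Finset.sum_const, Finset.card_univ, nsmul_eq_mul, Nat.card_eq_fintype_card,
    mul_div_cancel₀ _ (by exact_mod_cast Fintype.card_ne_zero)] at h2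
  linarith

/-- Composing with a map all of whose fibres have the same size does not change averages. -/
theorem av_comp_of_card_fiber {g : X → Y} {c : ℕ} (hc : c ≠ 0)
    (hg : ∀ y, Nat.card {x // g x = y} = c) (I : Type*) [Finite I] (F : (I → Y) → ℝ) :
    av (fun a : I → X => F (g ∘ a)) = av F := by
  have e1 : ∀ y, {x // g x = y} ≃ Fin c := fun y => Finite.equivFinOfCardEq (hg y)
  let e : X ≃ Y × Fin c :=
    (Equiv.sigmaFiberEquiv g).symm.trans ((Equiv.sigmaCongrRight e1).trans (Equiv.sigmaEquivProd _ _))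
  have he : ∀ x, (e x).1 = g x := fun x => rfl
  have : NeZero c := ⟨hc⟩
  let E : (I → X) ≃ (I → Y) × (I → Fin c) :=
    (Equiv.arrowCongr (Equiv.refl I) e).trans (Equiv.arrowProdEquivProdArrow I (fun _ => Y) fun _ => Fin c)
  have h := av_equiv E (fun p => F p.1)
  rw [av_prod] at h
  simp only [av_const] at h
  exact h

end Average

/-- The average of a product of independent weights. -/
theorem av_prod_pow {X : Type*} [Fintype X] (I : Type*) [Fintype I] (w : X → ℝ) :
    av (fun v : I → X => ∏ i, w (v i)) = av w ^ Fintype.card I := by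
  classical
  rw [av_eq_sum, av_eq_sum, div_pow, ← Finset.card_univ (α := I), ← Finset.prod_const,
    Finset.prod_univ_sum, Fintype.piFinset_univ]
  simp

/-- The point with parameters `x` of the combinatorial subspace described by `V`: a coordinate
is either a constant letter or a copy of a parameter. -/
def subspaceEval {α η ι : Type} (V : ι → α ⊕ η) (x : η → α) : ι → α :=
  fun i => Sum.elim id x (V i)

/-- Every parameter of the combinatorial subspace occurs. -/
def IsProper {α η ι : Type} (V : ι → α ⊕ η) : Prop := ∀ e, ∃ i, V i = Sum.inr e

/-- `A` contains a combinatorial line; `none` marks the wildcard positions. -/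
def HasLine {α ι : Type} (A : Set (ι → α)) : Prop :=
  ∃ u : ι → Option α, (∃ i, u i = none) ∧ ∀ a, (fun i => (u i).getD a) ∈ A

/-- The density Hales–Jewett property at a fixed density. -/
def DensityHJAt (α : Type) (δ : ℝ) : Prop :=
  ∃ N : ℕ, ∀ (ι : Type) [Finite ι], N ≤ Nat.card ι → ∀ A : Set (ι → α), δ ≤ dens A → HasLine A

/-- The density Hales–Jewett property of an alphabet. -/
def DensityHJ (α : Type) : Prop := ∀ δ : ℝ, 0 < δ → DensityHJAt α δ

/-- Substituting a subspace in a subspace. -/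
def subspaceComp {α η κ ι : Type} (V : ι → α ⊕ κ) (W : κ → α ⊕ η) : ι → α ⊕ η :=
  fun i => Sum.elim Sum.inl W (V i)

theorem subspaceEval_comp {α η κ ι : Type} (V : ι → α ⊕ κ) (W : κ → α ⊕ η) (x : η → α) :
    subspaceEval (subspaceComp V W) x = subspaceEval V (subspaceEval W x) := by
  funext i
  simp only [subspaceEval, subspaceComp]
  cases V i <;> rfl

theorem IsProper.comp {α η κ ι : Type} {V : ι → α ⊕ κ} {W : κ → α ⊕ η} (hV : IsProper V)
    (hW : IsProper W) : IsProper (subspaceComp V W) := by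
  intro e
  obtain ⟨k, hk⟩ := hW e
  obtain ⟨i, hi⟩ := hV k
  exact ⟨i, by simp [subspaceComp, hi, hk]⟩

theorem IsProper.injective {α η ι : Type} {V : ι → α ⊕ η} (hV : IsProper V) :
    Function.Injective (subspaceEval V) := by
  intro x y h
  funext e
  obtain ⟨i, hi⟩ := hV e
  simpa [subspaceEval, hi] using congrFun h i

theorem HasLine.of_preimage {α η ι : Type} {V : ι → α ⊕ η} (hV : IsProper V) {A : Set (ι → α)}
    (h : HasLine (subspaceEval V ⁻¹' A)) : HasLine A := by
  obtain ⟨u, ⟨e, he⟩, hu⟩ := h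
  obtain ⟨i, hi⟩ := hV e
  refine ⟨fun i => Sum.elim some u (V i), ⟨i, by simp [hi, he]⟩, fun a => ?_⟩
  have h1 : (fun i => (Sum.elim some u (V i)).getD a) =
      subspaceEval V fun i => (u i).getD a := by
    funext i
    simp only [subspaceEval]
    cases V i <;> rfl
  exact h1 ▸ hu a

/-- The subspace that re-indexes coordinates along an equivalence. -/
def subspaceReindex (α : Type) {κ ι : Type} (e : ι ≃ κ) : ι → α ⊕ κ := fun i => Sum.inr (e i)

theorem isProper_reindex (α : Type) {κ ι : Type} (e : ι ≃ κ) : IsProper (subspaceReindex α e) :=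
  fun k => ⟨e.symm k, by simp [subspaceReindex]⟩

theorem av_reindex {α κ ι : Type} [Finite α] [Finite κ] [Finite ι] (e : ι ≃ κ) (f : (ι → α) → ℝ) :
    av (fun x : κ → α => f (subspaceEval (subspaceReindex α e) x)) = av f :=
  av_equiv (Equiv.arrowCongr e.symm (Equiv.refl α)) f

theorem dens_reindex {α κ ι : Type} [Finite α] [Finite κ] [Finite ι] (e : ι ≃ κ)
    (A : Set (ι → α)) : dens (subspaceEval (subspaceReindex α e) ⁻¹' A) = dens A :=
  av_reindex e (A.indicator 1)

/-- The subspace of all points whose first block of coordinates is `x`. -/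
def subspaceFix {α : Type} {I : Type} (J : Type) (x : I → α) : I ⊕ J → α ⊕ J :=
  Sum.elim (fun i => Sum.inl (x i)) Sum.inr

theorem isProper_fix {α I : Type} (J : Type) (x : I → α) : IsProper (subspaceFix J x) :=
  fun j => ⟨Sum.inr j, rfl⟩

theorem subspaceEval_fix {α I J : Type} (x : I → α) (y : J → α) :
    subspaceEval (subspaceFix J x) y = Sum.elim x y := by
  funext i
  cases i <;> rfl

/-- The subspace of all points whose second block of coordinates is `y`. -/
def subspaceFixRight {α : Type} (I : Type) {J : Type} (y : J → α) : I ⊕ J → α ⊕ I :=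
  Sum.elim Sum.inr fun j => Sum.inl (y j)

theorem isProper_fixRight {α : Type} (I : Type) {J : Type} (y : J → α) :
    IsProper (subspaceFixRight I y) :=
  fun i => ⟨Sum.inl i, rfl⟩

theorem subspaceEval_fixRight {α I J : Type} (x : I → α) (y : J → α) :
    subspaceEval (subspaceFixRight I y) x = Sum.elim x y := by
  funext i
  cases i <;> rfl

theorem av_sumElim {α I J : Type} [Finite α] [Finite I] [Finite J] (f : (I ⊕ J → α) → ℝ) :
    av f = av fun x : I → α => av fun y : J → α => f (Sum.elim x y) := by
  rw [← av_equiv (Equiv.sumArrowEquivProdArrow I J α).symm f, av_prod]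
  rfl

theorem exists_equiv_sum {ι : Type} [Finite ι] {M : ℕ} (h : M ≤ Nat.card ι) :
    ∃ r, Nat.card ι = M + r ∧ Nonempty (ι ≃ Fin M ⊕ Fin r) := by
  obtain ⟨r, hr⟩ := Nat.exists_eq_add_of_le h
  exact ⟨r, hr, ⟨(Finite.equivFinOfCardEq hr).trans finSumFinEquiv.symm⟩⟩

theorem HasLine.of_equiv {α β ι : Type} (e : α ≃ β) {A : Set (ι → β)}
    (h : HasLine ((fun x : ι → α => e ∘ x) ⁻¹' A)) : HasLine A := by
  obtain ⟨u, ⟨i, hi⟩, hu⟩ := h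
  refine ⟨fun i => (u i).map e, ⟨i, by simp [hi]⟩, fun b => ?_⟩
  have h1 : (fun i => ((u i).map e).getD b) = e ∘ fun i => (u i).getD (e.symm b) := by
    funext i
    simp only [Function.comp]
    cases u i <;> simp
  exact h1 ▸ hu (e.symm b)

theorem DensityHJ.of_equiv {α β : Type} [Finite α] [Finite β] (e : α ≃ β) (h : DensityHJ α) :
    DensityHJ β := by
  intro δ hδ
  obtain ⟨N, hN⟩ := h δ hδ
  refine ⟨N, fun ι _ hι A hA => HasLine.of_equiv e (hN ι hι _ ?_)⟩
  convert hA using 1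
  exact av_equiv (Equiv.arrowCongr (Equiv.refl ι) e) (A.indicator 1)

theorem densityHJ_of_isEmpty (α : Type) [IsEmpty α] : DensityHJ α := by
  intro δ hδ
  refine ⟨1, fun ι _ hι A hA => ?_⟩
  have : Nonempty ι := (Nat.card_pos_iff.mp (by omega)).1
  obtain ⟨x, -⟩ := nonempty_of_dens_pos (hδ.trans_le hA)
  exact isEmptyElim (x (Classical.arbitrary ι))

/-- Multidimensional version: dense sets contain subspaces of any prescribed dimension. -/
theorem DensityHJ.exists_subspace {α : Type} [Finite α] [Nonempty α] (h : DensityHJ α) (m : ℕ) :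
    ∀ δ : ℝ, 0 < δ → ∃ N : ℕ, ∀ (ι : Type) [Finite ι], N ≤ Nat.card ι → ∀ A : Set (ι → α),
      δ ≤ dens A → ∃ V : ι → α ⊕ Fin m, IsProper V ∧ ∀ x, subspaceEval V x ∈ A := by
  induction m with
  | zero =>
    intro δ hδ
    refine ⟨0, fun ι _ _ A hA => ?_⟩
    obtain ⟨x, hx⟩ := nonempty_of_dens_pos (hδ.trans_le hA)
    exact ⟨fun i => Sum.inl (x i), fun e => e.elim0, fun _ => hx⟩
  | succ m ih =>
    intro δ hδ
    obtain ⟨N₁, hN₁⟩ := h (δ / 2) (half_pos hδ)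
    have hK : 0 < Nat.card (Fin N₁ → Option α) := Nat.card_pos
    obtain ⟨N₂, hN₂⟩ := ih (δ / 2 / Nat.card (Fin N₁ → Option α)) (by positivity)
    refine ⟨N₁ + N₂, fun ι _ hι A hA => ?_⟩
    obtain ⟨r, hr, ⟨e⟩⟩ := exists_equiv_sum (ι := ι) (M := N₁) (by omega)
    rw [← dens_reindex e A] at hA
    set B := subspaceEval (subspaceReindex α e) ⁻¹' A with hB
    have h1 : δ / 2 ≤ dens {y : Fin r → α | ∃ u : Fin N₁ → Option α,
        (∃ i, u i = none) ∧ ∀ a, Sum.elim (fun i => (u i).getD a) y ∈ B} := by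
      rw [dens, av_sumElim, av_comm] at hA
      refine (half_le_dens hδ.le (fun y => av_le_of_le fun x => indicator_one_le _ _) hA).trans
        (dens_mono fun y hy => ?_)
      exact hN₁ (Fin N₁) (by simp) {x | Sum.elim x y ∈ B} hy
    obtain ⟨u, hu⟩ := exists_dens_ge (half_pos hδ) h1
    obtain ⟨W, hW, hWA⟩ := hN₂ (Fin r) (by simp; omega) _ hu
    have hu0 := (hWA fun _ => Classical.arbitrary α).1
    let V : Fin N₁ ⊕ Fin r → α ⊕ Fin (m + 1) :=
      Sum.elim (fun i => (u i).elim (Sum.inr 0) Sum.inl) fun j => (W j).map id Fin.succ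
    have hV : IsProper V := by
      intro k
      refine Fin.cases ?_ (fun k => ?_) k
      · obtain ⟨i, hi⟩ := hu0
        exact ⟨Sum.inl i, by simp [V, hi]⟩
      · obtain ⟨j, hj⟩ := hW k
        exact ⟨Sum.inr j, by simp [V, hj]⟩
    refine ⟨subspaceComp (subspaceReindex α e) V, (isProper_reindex α e).comp hV, fun x => ?_⟩
    rw [subspaceEval_comp]
    have h2 : subspaceEval V x =
        Sum.elim (fun i => (u i).getD (x 0)) (subspaceEval W fun k => x k.succ) := by
      funext i
      rcases i with i | j
      · simp only [subspaceEval, V, Sum.elim_inl]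
        cases u i <;> rfl
      · simp only [subspaceEval, V, Sum.elim_inr]
        cases W j <;> rfl
    rw [h2]
    exact (hWA fun k => x k.succ).2 (x 0)

theorem exists_av_prod_lt {X : Type} [Fintype X] {w : X → ℝ} (h0 : ∀ x, 0 ≤ w x) (h1 : av w < 1)
    {ε : ℝ} (hε : 0 < ε) :
    ∃ M : ℕ, ∀ (I : Type) [Fintype I], M ≤ Nat.card I → av (fun v : I → X => ∏ i, w (v i)) < ε := by
  obtain ⟨M, hM⟩ := exists_pow_lt_of_lt_one hε h1
  refine ⟨M, fun I _ hI => ?_⟩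
  rw [av_prod_pow]
  refine (pow_le_pow_of_le_one (av_nonneg h0) h1.le ?_).trans_lt hM
  rwa [← Nat.card_eq_fintype_card]

open Classical in
/-- Overwrite by `ψ ∘ a` the coordinates of `v` that lie in the range of `ψ`. -/
noncomputable def resample {α Q I : Type} (ψ : α → Q) (v : I → Q)
    (a : {i // v i ∈ Set.range ψ} → α) : I → Q :=
  fun i => if h : v i ∈ Set.range ψ then ψ (a ⟨i, h⟩) else v i

theorem av_resample {α Q I : Type} [Finite α] [Finite Q] [Nonempty α] [Finite I] {ψ : α → Q}
    (hψ : Function.Injective ψ) (F : (I → Q) → ℝ) :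
    (av fun v : I → Q => av fun a => F (resample ψ v a)) = av F := by
  classical
  let g : Q × α → Q := fun p => if p.1 ∈ Set.range ψ then ψ p.2 else p.1
  have hg : ∀ q, Nat.card {p // g p = q} = Nat.card α := by
    intro q
    by_cases hq : q ∈ Set.range ψ
    · obtain ⟨a, rfl⟩ := hq
      refine Nat.card_congr (Equiv.ofBijective
        (fun b : α => (⟨(ψ b, a), by simp [g]⟩ : {p // g p = ψ a})) ⟨fun b c h => ?_, ?_⟩).symm
      · simp only [Subtype.mk.injEq, Prod.mk.injEq] at h
        exact hψ h.1
      · rintro ⟨⟨q, b⟩, h⟩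
        have h' := h
        simp only [g] at h'
        split_ifs at h' with hq
        · obtain ⟨c, rfl⟩ := hq
          obtain rfl := hψ h'
          exact ⟨c, rfl⟩
        · exact absurd ⟨a, h'.symm⟩ hq
    · refine Nat.card_congr (Equiv.ofBijective
        (fun b : α => (⟨(q, b), by simp only [g, if_neg hq]⟩ : {p // g p = q})) ⟨fun b c h => ?_, ?_⟩).symm
      · simpa using h
      · rintro ⟨⟨q', b⟩, h⟩
        simp only [g] at h
        split_ifs at h with hq'
        · exact absurd ⟨b, h⟩ hq
        · subst h
          exact ⟨b, rfl⟩
  rw [← av_comp_of_card_fiber (Nat.card_pos (α := α)).ne' hg I F,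
    ← av_equiv (Equiv.arrowProdEquivProdArrow I (fun _ => Q) fun _ => α).symm, av_prod]
  congr 1
  funext v
  rw [← av_equiv (Equiv.piEquivPiSubtypeProd (fun i => v i ∈ Set.range ψ) fun _ => α).symm, av_prod]
  congr 1
  funext a
  rw [← av_const (X := {i // v i ∉ Set.range ψ} → α) (F (resample ψ v a))]
  congr 1
  funext b
  congr 1
  funext i
  by_cases hi : v i ∈ Set.range ψ
  · obtain ⟨c, hc⟩ := hi
    simp [resample, g, Equiv.piEquivPiSubtypeProd, Equiv.arrowProdEquivProdArrow, ← hc]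
  · have hi' : ∀ c, ψ c ≠ v i := fun c hc => hi ⟨c, hc⟩
    simp [resample, g, Equiv.piEquivPiSubtypeProd, Equiv.arrowProdEquivProdArrow, hi']

/-- A function with large average has large average on some set of points that vary freely on
many coordinates. -/
theorem exists_resample {α Q : Type} [Finite α] [Finite Q] [Nonempty α] {ψ : α → Q}
    (hψ : Function.Injective ψ) {κ : ℝ} (hκ : 0 < κ) (M' : ℕ) :
    ∃ M : ℕ, ∀ (I : Type) [Finite I], M ≤ Nat.card I → ∀ F : (I → Q) → ℝ, (∀ v, F v ≤ 1) →
      κ ≤ av F → ∃ v : I → Q, M' ≤ Nat.card {i // v i ∈ Set.range ψ} ∧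
        κ / 2 ≤ av fun a => F (resample ψ v a) := by
  classical
  have := Fintype.ofFinite Q
  have hQ : Nonempty Q := ⟨ψ (Classical.arbitrary α)⟩
  let w : Q → ℝ := fun q => if q ∈ Set.range ψ then 1 / 2 else 1
  have hw0 : ∀ q, 0 ≤ w q := fun q => by simp only [w]; split_ifs <;> norm_num
  have hw1 : av w < 1 := by
    by_contra! h
    have h2 : av w + av (fun q => (1 : ℝ) - w q) = 1 := by
      rw [← av_add]; simp [av_const]
    have h3 := le_av_single (f := fun q => (1 : ℝ) - w q)
      (fun q => by simp only [w]; split_ifs <;> norm_num) (ψ (Classical.arbitrary α))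
    have h4 : (0 : ℝ) < (1 - w (ψ (Classical.arbitrary α))) / Nat.card Q := by
      have : (0 : ℝ) < Nat.card Q := by exact_mod_cast Nat.card_pos
      simp only [w, Set.mem_range_self, if_true]
      positivity
    linarith
  obtain ⟨M, hM⟩ := exists_av_prod_lt hw0 hw1 (ε := κ / 2 / 2 ^ M') (by positivity)
  refine ⟨M, fun I _ hI F hF hκF => ?_⟩
  have := Fintype.ofFinite I
  by_contra! hc
  have hneI : Nonempty (I → Q) := inferInstance
  have key : av F ≤ av fun v : I → Q => κ / 2 + 2 ^ M' * ∏ i, w (v i) := by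
    rw [← av_resample hψ F]
    refine av_mono fun v => ?_
    have hp : 0 ≤ ∏ i, w (v i) := Finset.prod_nonneg fun i _ => hw0 _
    by_cases hv : M' ≤ Nat.card {i // v i ∈ Set.range ψ}
    · have := hc v hv
      have : (0 : ℝ) ≤ 2 ^ M' * ∏ i, w (v i) := by positivity
      linarith
    · have h1 : av (fun a => F (resample ψ v a)) ≤ 1 := av_le_of_le fun a => hF _
      have h2 : ∏ i, w (v i) = (1 / 2) ^ Nat.card {i // v i ∈ Set.range ψ} := by
        simp only [w]
        rw [Finset.prod_ite]
        simp [Nat.card_eq_fintype_card, Fintype.card_subtype]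
      have h3 : (1 : ℝ) ≤ 2 ^ M' * ∏ i, w (v i) := by
        rw [h2]
        have : ((1 : ℝ) / 2) ^ M' ≤ (1 / 2) ^ Nat.card {i // v i ∈ Set.range ψ} :=
          pow_le_pow_of_le_one (by norm_num) (by norm_num) (by omega)
        calc (1 : ℝ) = 2 ^ M' * (1 / 2) ^ M' := by rw [← mul_pow]; norm_num
          _ ≤ _ := by gcongr
      linarith
  rw [av_add, av_const, av_const_mul] at key
  have h5 := hM I hI
  rw [lt_div_iff₀ (by positivity)] at h5
  linarith

/-- Membership in `D` does not change when the letter `none` is replaced by `b`. -/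
def Insensitive {β ι : Type} (b : β) (D : Set (ι → Option β)) : Prop :=
  ∀ x, x ∈ D ↔ (fun i => some ((x i).getD b)) ∈ D

theorem Insensitive.preimage {β η ι : Type} {b : β} {D : Set (ι → Option β)} (hD : Insensitive b D)
    (V : ι → Option β ⊕ η) : Insensitive b (subspaceEval V ⁻¹' D) := by
  intro x
  rw [Set.mem_preimage, Set.mem_preimage, hD, hD (subspaceEval V fun i => some ((x i).getD b))]
  have : (fun i => some ((subspaceEval V x i).getD b)) =
      fun i => some ((subspaceEval V (fun i => some ((x i).getD b)) i).getD b) := by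
    funext i
    simp only [subspaceEval]
    cases V i <;> simp
  rw [this]

theorem Insensitive.section_left {β I J : Type} {b : β} {D : Set (I ⊕ J → Option β)}
    (hD : Insensitive b D) (x : I → Option β) : Insensitive b {y : J → Option β | Sum.elim x y ∈ D} := by
  have := hD.preimage (subspaceFix J x)
  simpa only [Set.preimage, subspaceEval_fix] using this

theorem Insensitive.section_right {β I J : Type} {b : β} {D : Set (I ⊕ J → Option β)}
    (hD : Insensitive b D) (y : J → Option β) : Insensitive b {x : I → Option β | Sum.elim x y ∈ D} := by
  have := hD.preimage (subspaceFixRight I y)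
  simpa only [Set.preimage, subspaceEval_fixRight] using this

theorem Insensitive.compl {β ι : Type} {b : β} {D : Set (ι → Option β)} (hD : Insensitive b D) :
    Insensitive b Dᶜ := fun x => not_congr (hD x)

theorem DensityHJ.exists_subspace_insensitive {β : Type} [Finite β] (h : DensityHJ β) (b : β) (m : ℕ)
    {ε : ℝ} (hε : 0 < ε) : ∃ N : ℕ, ∀ (ι : Type) [Finite ι], N ≤ Nat.card ι →
      ∀ D : Set (ι → Option β), Insensitive b D → ε ≤ dens D →
        ∃ V : ι → Option β ⊕ Fin m, IsProper V ∧ ∀ x, subspaceEval V x ∈ D := by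
  classical
  have : Nonempty β := ⟨b⟩
  obtain ⟨M', hM'⟩ := h.exists_subspace m (ε / 2) (half_pos hε)
  obtain ⟨M, hM⟩ := exists_resample (Option.some_injective β) hε M'
  refine ⟨M, fun ι _ hι D hD hεD => ?_⟩
  obtain ⟨v, hv, hav⟩ := hM ι hι (D.indicator 1) (indicator_one_le D) hεD
  obtain ⟨W, hW, hWA⟩ := hM' {i // v i ∈ Set.range some} hv {a | resample some v a ∈ D} hav
  refine ⟨fun i => if h : v i ∈ Set.range some then (W ⟨i, h⟩).map some id else Sum.inl (v i),
    fun e => ?_, fun x => ?_⟩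
  · obtain ⟨⟨i, hi⟩, hie⟩ := hW e
    exact ⟨i, by simp only [dif_pos hi, hie]; rfl⟩
  · rw [hD]
    have h1 := hWA fun e => (x e).getD b
    rw [Set.mem_ofPred_eq, hD] at h1
    convert h1 using 3 with i
    by_cases hi : v i ∈ Set.range some
    · simp only [subspaceEval, resample, dif_pos hi]
      cases W ⟨i, hi⟩ <;> simp
    · simp only [subspaceEval, resample, dif_neg hi]
      simp

theorem av_indicator_range {U X : Type} [Finite U] [Finite X] [Nonempty U] {φ : U → X}
    (hφ : Function.Injective φ) (g : X → ℝ) :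
    av ((Set.range φ).indicator g) = dens (Set.range φ) * av (fun u => g (φ u)) := by
  classical
  have := Fintype.ofFinite U
  have := Fintype.ofFinite X
  have key : ∀ g : X → ℝ, ∑ x, (Set.range φ).indicator g x = ∑ u, g (φ u) := by
    intro g
    rw [← Finset.sum_image (s := Finset.univ) (g := φ) (f := g) hφ.injOn, Finset.sum_indicator_eq_sum_filter
      (s := Finset.univ) (f := fun _ => g) (t := fun _ => Set.range φ) (g := fun x => x)]
    congr 1
    ext x
    simp
  have hU : (Fintype.card U : ℝ) ≠ 0 := by exact_mod_cast Fintype.card_ne_zero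
  rw [dens, av_eq_sum, av_eq_sum, av_eq_sum, key, key]
  simp only [Pi.one_apply, Finset.sum_const, Finset.card_univ, nsmul_eq_mul, mul_one]
  field_simp

/-- If `f` has small average on every `m`-dimensional subspace of an insensitive set `D`, then
its integral over `D` is small, up to a proportion `c` of `D`. -/
def CoverBound {β : Type} (b : β) (m : ℕ) (ε c : ℝ) : Prop :=
  ∃ N : ℕ, ∀ (ι : Type) [Finite ι], N ≤ Nat.card ι → ∀ (D : Set (ι → Option β))
    (f : (ι → Option β) → ℝ), Insensitive b D → (∀ x, f x ≤ 1) →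
    (∀ V : ι → Option β ⊕ Fin m, IsProper V → (∀ x, subspaceEval V x ∈ D) →
      av (fun x => f (subspaceEval V x)) ≤ ε) →
    av (D.indicator f) ≤ ε * dens D + ε + c * dens D

theorem av_indicator_le_dens {X : Type} [Finite X] (D : Set X) {f : X → ℝ} (hf : ∀ x, f x ≤ 1) :
    av (D.indicator f) ≤ dens D :=
  av_mono fun x => Set.indicator_le_indicator (hf x)

theorem coverBound_one {β : Type} [Finite β] (b : β) (m : ℕ) {ε : ℝ} (hε : 0 < ε) :
    CoverBound b m ε 1 := by
  refine ⟨0, fun ι _ _ D f _ hf _ => ?_⟩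
  have h1 := av_indicator_le_dens D hf
  have h2 : 0 ≤ ε * dens D := mul_nonneg hε.le (dens_nonneg D)
  linarith

theorem coverBound_step_sum {β I J : Type} [Finite β] [Finite I] [Finite J] {b : β} {m : ℕ} {ε c : ℝ}
    (hε : 0 < ε) (hc : 0 ≤ c) {D : Set (I ⊕ J → Option β)} {f : (I ⊕ J → Option β) → ℝ}
    (hD : Insensitive b D)
    (hsub : ∀ V : I ⊕ J → Option β ⊕ Fin m, IsProper V → (∀ x, subspaceEval V x ∈ D) →
      av (fun x => f (subspaceEval V x)) ≤ ε)
    {V : I → Option β ⊕ Fin m} (hV : IsProper V) {C : Set (J → Option β)} (hC : Insensitive b C)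
    (hVC : ∀ y ∈ C, ∀ x, Sum.elim (subspaceEval V x) y ∈ D)
    (hJ : ∀ (D : Set (J → Option β)) (f : (J → Option β) → ℝ), Insensitive b D → (∀ x, f x ≤ 1) →
      (∀ V : J → Option β ⊕ Fin m, IsProper V → (∀ x, subspaceEval V x ∈ D) →
        av (fun x => f (subspaceEval V x)) ≤ ε) →
      av (D.indicator f) ≤ ε * dens D + ε + c * dens D)
    (hf : ∀ x, f x ≤ 1) :
    av (D.indicator f) ≤
      ε * dens D + ε + c * (dens D - dens (Set.range (subspaceEval V)) * dens C) := by
  set R := Set.range (subspaceEval V) with hR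
  let E : (I → Option β) → Set (J → Option β) := fun x =>
    {y | Sum.elim x y ∈ D ∧ ¬ (x ∈ R ∧ y ∈ C)}
  have hsplit : ∀ g : (I ⊕ J → Option β) → ℝ, av (D.indicator g) =
      av (fun y => C.indicator 1 y * av (R.indicator fun x => g (Sum.elim x y))) +
        av fun x => av ((E x).indicator fun y => g (Sum.elim x y)) := by
    intro g
    rw [av_sumElim]
    have h1 : ∀ y, C.indicator 1 y * av (R.indicator fun x => g (Sum.elim x y)) =
        av fun x => C.indicator 1 y * R.indicator (fun x => g (Sum.elim x y)) x :=
      fun y => (av_const_mul _ _).symm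
    simp only [h1]
    rw [av_comm (fun (y : J → Option β) x => C.indicator 1 y * R.indicator (fun x => g (Sum.elim x y)) x),
      ← av_add]
    congr 1
    funext x
    rw [← av_add]
    congr 1
    funext y
    by_cases hx : x ∈ R
    · by_cases hy : y ∈ C
      · have hxy : Sum.elim x y ∈ D := by
          obtain ⟨u, rfl⟩ := hx
          exact hVC y hy u
        simp [E, hx, hy, hxy]
      · have hiff : y ∈ E x ↔ Sum.elim x y ∈ D := and_iff_left fun h => hy h.2
        rw [Set.indicator_of_notMem hy, zero_mul, zero_add]
        by_cases h : Sum.elim x y ∈ D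
        · rw [Set.indicator_of_mem h, Set.indicator_of_mem (hiff.2 h)]
        · rw [Set.indicator_of_notMem h, Set.indicator_of_notMem (mt hiff.1 h)]
    · have hiff : y ∈ E x ↔ Sum.elim x y ∈ D := and_iff_left fun h => hx h.1
      rw [Set.indicator_of_notMem hx, mul_zero, zero_add]
      by_cases h : Sum.elim x y ∈ D
      · rw [Set.indicator_of_mem h, Set.indicator_of_mem (hiff.2 h)]
      · rw [Set.indicator_of_notMem h, Set.indicator_of_notMem (mt hiff.1 h)]
  have hdens : dens D = dens C * dens R + av fun x => dens (E x) := by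
    have := hsplit 1
    rw [dens, this]
    congr 1
    have : ∀ y, C.indicator 1 y * av (R.indicator fun x => (1 : (I ⊕ J → Option β) → ℝ) (Sum.elim x y)) =
        dens R * C.indicator 1 y := fun y => mul_comm _ _
    simp only [this]
    rw [av_const_mul, mul_comm]
    rfl
  have hfirst : av (fun y => C.indicator 1 y * av (R.indicator fun x => f (Sum.elim x y))) ≤
      dens R * ε * dens C := by
    rw [dens, dens, ← av_const_mul]
    refine av_mono fun y => ?_
    by_cases hy : y ∈ C
    · simp only [Set.indicator_of_mem hy, Pi.one_apply, one_mul, mul_one]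
      rw [hR, av_indicator_range hV.injective]
      refine mul_le_mul_of_nonneg_left ?_ (dens_nonneg _)
      have := hsub (subspaceComp (subspaceFixRight I y) V) ((isProper_fixRight I y).comp hV)
        fun x => by
          rw [subspaceEval_comp, subspaceEval_fixRight]
          exact hVC y hy x
      simpa only [subspaceEval_comp, subspaceEval_fixRight] using this
    · simp [Set.indicator_of_notMem hy]
  have hsecond : av (fun x => av ((E x).indicator fun y => f (Sum.elim x y))) ≤
      av fun x => (ε + c) * dens (E x) + ε := by
    refine av_mono fun x => ?_
    have hE : Insensitive b (E x) := by
      intro y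
      have h1 := hD.section_left x y
      have h2 := hC y
      simp only [E, Set.mem_ofPred_eq] at h1 ⊢
      rw [h1, h2]
    have := hJ (E x) (fun y => f (Sum.elim x y)) hE (fun y => hf _) fun W hW hWE => by
      have := hsub (subspaceComp (subspaceFix J x) W) ((isProper_fix J x).comp hW)
        fun u => by
          rw [subspaceEval_comp, subspaceEval_fix]
          exact (hWE u).1
      simpa only [subspaceEval_comp, subspaceEval_fix] using this
    linarith
  rw [av_add, av_const_mul, av_const] at hsecond
  rw [hsplit f]
  nlinarith

theorem DensityHJ.coverBound_step {β : Type} [Finite β] (h : DensityHJ β) (b : β) (m : ℕ)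
    {ε : ℝ} (hε : 0 < ε) : ∃ p : ℝ, 0 < p ∧ p ≤ 1 ∧ ∀ c, 0 ≤ c → CoverBound b m ε c →
      CoverBound b m ε (c * (1 - p)) := by
  obtain ⟨N₁, hN₁⟩ := h.exists_subspace_insensitive b m (half_pos hε)
  set K : ℕ := Nat.card (Fin N₁ → Option β ⊕ Fin m) with hK
  set L : ℕ := Nat.card (Fin N₁ → Option β) with hL
  have hKpos : (0 : ℝ) < K := by exact_mod_cast Nat.card_pos
  have hLpos : (0 : ℝ) < L := by exact_mod_cast Nat.card_pos
  refine ⟨min 1 (1 / L * (ε / 2 / K)), by positivity, min_le_left _ _, fun c hc hcov => ?_⟩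
  set p : ℝ := min 1 (1 / L * (ε / 2 / K)) with hp
  have hp0 : 0 < p := by positivity
  have hp1 : p ≤ 1 := min_le_left _ _
  obtain ⟨N₂, hN₂⟩ := hcov
  refine ⟨N₁ + N₂, fun ι _ hι D f hD hf hsub => ?_⟩
  have hd0 := dens_nonneg D
  have hd1 := dens_le_one D
  rcases lt_or_ge (dens D) ε with hlt | hge
  · have h1 := av_indicator_le_dens D hf
    have h2 : 0 ≤ ε * dens D := by positivity
    have h3 : 0 ≤ c * (1 - p) * dens D := mul_nonneg (mul_nonneg hc (by linarith)) hd0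
    linarith
  obtain ⟨r, hr, ⟨e⟩⟩ := exists_equiv_sum (ι := ι) (M := N₁) (by omega)
  have hav : av (D.indicator f) = _ := (av_reindex e (D.indicator f)).symm
  rw [hav]
  rw [← dens_reindex e D] at hge hd0 hd1 ⊢
  set φ := subspaceEval (subspaceReindex (Option β) e) with hφ
  have hD' : Insensitive b (φ ⁻¹' D) := hD.preimage _
  set D' := φ ⁻¹' D with hDdef
  have h1 : ε / 2 ≤ dens {y : Fin r → Option β | ∃ V : Fin N₁ → Option β ⊕ Fin m,
      IsProper V ∧ ∀ x, Sum.elim (subspaceEval V x) y ∈ D'} := by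
    rw [dens, av_sumElim, av_comm] at hge
    refine (half_le_dens hε.le (fun y => av_le_of_le fun x => indicator_one_le _ _) hge).trans
      (dens_mono fun y hy => ?_)
    exact hN₁ (Fin N₁) (by simp) {x | Sum.elim x y ∈ D'} (hD'.section_right y) hy
  obtain ⟨V, hVd⟩ := exists_dens_ge (half_pos hε) h1
  rw [← hK] at hVd
  obtain ⟨y₀, hV, -⟩ := nonempty_of_dens_pos (lt_of_lt_of_le (by positivity) hVd)
  set C := {y : Fin r → Option β | IsProper V ∧ ∀ x, Sum.elim (subspaceEval V x) y ∈ D'} with hCdef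
  have hC : Insensitive b C := fun y =>
    and_congr_right fun _ => forall_congr' fun x => hD'.section_left (subspaceEval V x) y
  have key := coverBound_step_sum (f := fun x => f (φ x)) hε hc hD' (fun W hW hWD => by
      have := hsub (subspaceComp (subspaceReindex (Option β) e) W) ((isProper_reindex _ e).comp hW)
        fun x => by
          rw [subspaceEval_comp]
          exact hWD x
      simpa only [subspaceEval_comp] using this)
    hV hC (fun y hy x => hy.2 x) (hN₂ (Fin r) (by simp; omega)) (fun x => hf _)
  refine le_trans key ?_
  have hR : 1 / (L : ℝ) ≤ dens (Set.range (subspaceEval V)) := by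
    have := le_av_single (f := (Set.range (subspaceEval V)).indicator (1 : (Fin N₁ → Option β) → ℝ))
      (fun _ => Set.indicator_nonneg (fun _ _ => zero_le_one) _) (subspaceEval V fun _ => none)
    rwa [Set.indicator_of_mem (Set.mem_range_self _)] at this
  have h2 : p ≤ dens (Set.range (subspaceEval V)) * dens C :=
    (min_le_right _ _).trans (mul_le_mul hR hVd (by positivity) (dens_nonneg _))
  have h3 : p * dens D' ≤ p := mul_le_of_le_one_right hp0.le hd1
  have h4 : c * (dens D' - dens (Set.range (subspaceEval V)) * dens C) ≤ c * (1 - p) * dens D' := by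
    rw [mul_assoc]
    exact mul_le_mul_of_nonneg_left (by linarith) hc
  linarith

theorem DensityHJ.av_insensitive_le {β : Type} [Finite β] (h : DensityHJ β) (b : β) (m : ℕ)
    {ε : ℝ} (hε : 0 < ε) : ∃ N : ℕ, ∀ (ι : Type) [Finite ι], N ≤ Nat.card ι →
      ∀ (D : Set (ι → Option β)) (f : (ι → Option β) → ℝ), Insensitive b D → (∀ x, f x ≤ 1) →
      (∀ V : ι → Option β ⊕ Fin m, IsProper V → (∀ x, subspaceEval V x ∈ D) →
        av (fun x => f (subspaceEval V x)) ≤ ε) → av (D.indicator f) ≤ 3 * ε := by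
  obtain ⟨p, hp0, hp1, hp⟩ := h.coverBound_step b m hε
  have hpow : ∀ j : ℕ, CoverBound b m ε ((1 - p) ^ j) := by
    intro j
    induction j with
    | zero => simpa using coverBound_one b m hε
    | succ j ih =>
      rw [pow_succ]
      exact hp _ (pow_nonneg (by linarith) j) ih
  obtain ⟨j, hj⟩ := exists_pow_lt_of_lt_one hε (show 1 - p < 1 by linarith)
  obtain ⟨N, hN⟩ := hpow j
  refine ⟨N, fun ι _ hι D f hD hf hsub => (hN ι hι D f hD hf hsub).trans ?_⟩
  have h0 := dens_nonneg D
  have h1 := dens_le_one D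
  nlinarith

theorem DensityHJ.av_iInter_insensitive_le {β : Type} [Finite β] (h : DensityHJ β) (m : ℕ)
    (s : Finset β) : ∀ ε : ℝ, 0 < ε → ∃ N : ℕ, ∀ (ι : Type) [Finite ι], N ≤ Nat.card ι →
      ∀ (D : β → Set (ι → Option β)) (f : (ι → Option β) → ℝ), (∀ b ∈ s, Insensitive b (D b)) →
      (∀ x, f x ≤ 1) → (∀ V : ι → Option β ⊕ Fin m, IsProper V →
        av (fun x => f (subspaceEval V x)) ≤ 0) →
      av ((⋂ b ∈ s, D b).indicator f) ≤ ε := by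
  classical
  induction s using Finset.induction_on with
  | empty =>
    intro ε hε
    refine ⟨m, fun ι _ hι D f _ hf hsub => ?_⟩
    obtain ⟨r, hr, ⟨e⟩⟩ := exists_equiv_sum hι
    simp only [Finset.notMem_empty, Set.iInter_of_empty, Set.iInter_univ, Set.indicator_univ]
    rw [← av_reindex e f, av_sumElim, av_comm]
    refine av_le_of_le fun y => le_trans (le_of_eq ?_) ((hsub (subspaceComp (subspaceReindex (Option β) e)
      (subspaceFixRight (Fin m) y)) ((isProper_reindex _ e).comp (isProper_fixRight _ y))).trans hε.le)
    simp only [subspaceEval_comp, subspaceEval_fixRight]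
  | insert b s hb ih =>
    intro ε hε
    obtain ⟨M, hM⟩ := ih (ε / 3) (by positivity)
    obtain ⟨N, hN⟩ := h.av_insensitive_le b M (ε := ε / 3) (by positivity)
    refine ⟨N, fun ι _ hι D f hD hf hsub => ?_⟩
    have h1 : (⋂ b' ∈ insert b s, D b').indicator f = (D b).indicator ((⋂ b' ∈ s, D b').indicator f) := by
      rw [Set.indicator_indicator, Finset.set_biInter_insert]
    rw [h1]
    have hle := hN ι hι (D b) ((⋂ b' ∈ s, D b').indicator f) (hD b (Finset.mem_insert_self b s))
      (fun x => (Set.indicator_le_indicator (hf x)).trans (indicator_one_le _ x)) fun V hV _ => ?_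
    · linarith
    · have := hM (Fin M) (by simp) (fun b' => subspaceEval V ⁻¹' D b') (fun x => f (subspaceEval V x))
        (fun b' hb' => (hD b' (Finset.mem_insert_of_mem hb')).preimage V) (fun x => hf _)
        fun W hW => by
          have := hsub (subspaceComp V W) (hV.comp hW)
          simpa only [subspaceEval_comp] using this
      convert this using 2
      funext x
      simp [Set.indicator]

theorem av_indicator_compl_iInter_le {X B : Type} [Finite X] (D : B → Set X) (f : X → ℝ) {c : ℝ}
    (h : ∀ (b : B) (t : Finset B), b ∉ t → av (((D b)ᶜ ∩ ⋂ b' ∈ t, D b').indicator f) ≤ c)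
    (s : Finset B) : av ((⋂ b ∈ s, D b)ᶜ.indicator f) ≤ s.card * c := by
  classical
  induction s using Finset.induction_on with
  | empty => simp [av]
  | insert b s hb ih =>
    have h1 : (⋂ b' ∈ insert b s, D b')ᶜ.indicator f = fun x =>
        (⋂ b' ∈ s, D b')ᶜ.indicator f x + ((D b)ᶜ ∩ ⋂ b' ∈ s, D b').indicator f x := by
      funext x
      rw [Finset.set_biInter_insert]
      generalize (⋂ b' ∈ s, D b') = E
      by_cases hx : x ∈ E <;> by_cases hxb : x ∈ D b <;> simp [hx, hxb]
    rw [h1, av_add, Finset.card_insert_of_notMem hb]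
    push_cast
    have := h b s hb
    linarith

/-- The points of a section of `A` that stay in `A` when the letter `none` is replaced by `b`. -/
def replaceSet {β I J : Type} (A : Set (I ⊕ J → Option β)) (b : β) (y : J → Option β) :
    Set (I → Option β) :=
  {x | Sum.elim (fun i => some ((x i).getD b)) y ∈ A}

theorem insensitive_replaceSet {β I J : Type} (A : Set (I ⊕ J → Option β)) (b : β)
    (y : J → Option β) : Insensitive b (replaceSet A b y) := by
  intro x
  simp [replaceSet]

theorem hasLine_of_mem_replaceSet {β I J : Type} {A : Set (I ⊕ J → Option β)} {x : I → Option β}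
    {y : J → Option β} (hx : ∃ i, x i = none) (hA : Sum.elim x y ∈ A)
    (h : ∀ b, x ∈ replaceSet A b y) : HasLine A := by
  obtain ⟨i, hi⟩ := hx
  refine ⟨Sum.elim (fun i => (x i).map some) fun j => some (y j), ⟨Sum.inl i, by simp [hi]⟩, fun a => ?_⟩
  cases a with
  | none =>
    convert hA using 1
    funext i
    rcases i with i | j
    · simp only [Sum.elim_inl]
      cases x i <;> rfl
    · rfl
  | some b =>
    have := h b
    rw [replaceSet, Set.mem_ofPred_eq] at this
    convert this using 1
    funext i
    rcases i with i | j
    · simp only [Sum.elim_inl]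
      cases x i <;> rfl
    · rfl

/-- Evaluation of words over letters of `β` and positions of the template `u`. -/
def templateEval {β K I : Type} (u : K → Option β) (v : I → β ⊕ K) : I → Option β :=
  fun i => Sum.elim some u (v i)

/-- The letter `b` is a letter, and `none` is the position `j`. -/
def letterOrPos {β K : Type} (j : K) : Option β → β ⊕ K := fun a => a.elim (Sum.inr j) Sum.inl

theorem letterOrPos_injective {β K : Type} (j : K) :
    Function.Injective (letterOrPos j : Option β → β ⊕ K) := by
  intro a b h
  cases a <;> cases b <;> simp_all [letterOrPos]

/-- The subspace traced out by resampling `v` at the position `j` and at all letters. -/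
noncomputable def templateSubspace {β K I : Type} (u : K → Option β) (j : K) (v : I → β ⊕ K) :
    I → Option β ⊕ {i // v i ∈ Set.range (letterOrPos j : Option β → β ⊕ K)} :=
  open Classical in fun i => if h : v i ∈ Set.range (letterOrPos j : Option β → β ⊕ K) then
    Sum.inr ⟨i, h⟩ else Sum.inl (templateEval u v i)

theorem isProper_templateSubspace {β K I : Type} (u : K → Option β) (j : K) (v : I → β ⊕ K) :
    IsProper (templateSubspace u j v) :=
  fun e => ⟨e.1, by simp only [templateSubspace, dif_pos e.2]⟩

theorem subspaceEval_templateSubspace {β K I : Type} {u : K → Option β} {j : K} (hj : u j = none)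
    (v : I → β ⊕ K) (a : {i // v i ∈ Set.range (letterOrPos j : Option β → β ⊕ K)} → Option β) :
    subspaceEval (templateSubspace u j v) a = templateEval u (resample (letterOrPos j) v a) := by
  funext i
  by_cases h : v i ∈ Set.range (letterOrPos j : Option β → β ⊕ K)
  · simp only [subspaceEval, templateSubspace, templateEval, resample, dif_pos h, Sum.elim_inr]
    cases a ⟨i, h⟩ <;> simp [letterOrPos, hj]
  · simp only [subspaceEval, templateSubspace, templateEval, resample, dif_neg h, Sum.elim_inl, id]

open Classical in
/-- A letter of `β ⊕ K` gets weight zero if it is the position `j`. -/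
noncomputable def avoidWeight {β K : Type} (j : K) (q : β ⊕ K) : ℝ := if q = Sum.inr j then 0 else 1

theorem avoidWeight_nonneg {β K : Type} (j : K) (q : β ⊕ K) : 0 ≤ avoidWeight j q := by
  unfold avoidWeight
  split_ifs <;> norm_num

theorem av_avoidWeight_lt {β K : Type} [Finite β] [Finite K] (j : K) :
    av (avoidWeight j : β ⊕ K → ℝ) < 1 := by
  have hQ : Nonempty (β ⊕ K) := ⟨Sum.inr j⟩
  have h2 : av (avoidWeight j : β ⊕ K → ℝ) + av (fun q => (1 : ℝ) - avoidWeight (β := β) j q) = 1 := by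
    rw [← av_add]
    simp [av_const]
  have h3 := le_av_single (f := fun q => (1 : ℝ) - avoidWeight (β := β) j q)
    (fun q => by unfold avoidWeight; split_ifs <;> norm_num) (Sum.inr j)
  have h4 : (0 : ℝ) < 1 / Nat.card (β ⊕ K) := by
    have : (0 : ℝ) < Nat.card (β ⊕ K) := by exact_mod_cast Nat.card_pos
    positivity
  have h5 : avoidWeight (β := β) j (Sum.inr j) = 0 := by simp [avoidWeight]
  rw [h5, sub_zero] at h3
  linarith

theorem one_le_prod_avoidWeight {β K I : Type} [Fintype I] {u : K → Option β} {j : K}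
    (hj : u j = none) {v : I → β ⊕ K} (hv : ∀ i, templateEval u v i ≠ none) :
    1 ≤ ∏ i, avoidWeight j (v i) := by
  refine le_of_eq (Finset.prod_eq_one fun i _ => ?_).symm
  have : v i ≠ Sum.inr j := fun h => hv i (by simp [templateEval, h, hj])
  simp [avoidWeight, this]

theorem exists_forall_le {K : Type} [Finite K] (f : K → ℕ) : ∃ N, ∀ k, f k ≤ N := by
  obtain ⟨N, hN⟩ := (Set.finite_range f).bddAbove
  exact ⟨N, fun k => hN ⟨k, rfl⟩⟩

theorem exists_dense_template {β I J : Type} [Finite β] [Finite I] [Finite J] [Nonempty β] {d : ℝ}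
    {K : Type} [Finite K] (hK : ∀ A : Set (K → β), d / 4 ≤ dens A → HasLine A) (hd : 0 < d)
    {A : Set (I ⊕ J → Option β)} (hA : ∀ x : I → Option β, d / 2 ≤ dens {y | Sum.elim x y ∈ A}) :
    ∃ u : K → Option β, (∃ j, u j = none) ∧ d / 4 / Nat.card (K → Option β) ≤
      dens {p : (I → β ⊕ K) × (J → Option β) | ∀ b, templateEval u p.1 ∈ replaceSet A b p.2} := by
  have h1 : ∀ v : I → β ⊕ K, d / 4 ≤ dens {y : J → Option β | d / 4 ≤
      dens {u : K → β | Sum.elim (templateEval (fun k => some (u k)) v) y ∈ A}} := by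
    intro v
    have h2 : d / 2 ≤ av fun y : J → Option β =>
        dens {u : K → β | Sum.elim (templateEval (fun k => some (u k)) v) y ∈ A} := by
      simp only [dens]
      rw [av_comm]
      exact le_av_of_le fun u => hA _
    have := half_le_dens (by positivity) (fun y => dens_le_one _) h2
    rwa [show d / 2 / 2 = d / 4 by ring] at this
  have h3 : d / 4 ≤ dens {p : (I → β ⊕ K) × (J → Option β) | ∃ u : K → Option β,
      (∃ j, u j = none) ∧ ∀ b, templateEval u p.1 ∈ replaceSet A b p.2} := by
    have : Nonempty (I → β ⊕ K) := ⟨fun _ => Sum.inl (Classical.arbitrary β)⟩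
    rw [dens, av_prod]
    refine le_av_of_le fun v => (h1 v).trans (dens_mono fun y hy => ?_)
    obtain ⟨u, hu, hu'⟩ := hK _ hy
    refine ⟨u, hu, fun b => ?_⟩
    have h4 := hu' b
    rw [Set.mem_ofPred_eq] at h4
    rw [replaceSet, Set.mem_ofPred_eq]
    convert h4 using 2
    funext i
    simp only [templateEval]
    cases v i <;> rfl
  obtain ⟨u, hu⟩ := exists_dens_ge (by positivity) h3
  obtain ⟨p, hp, -⟩ := nonempty_of_dens_pos (lt_of_lt_of_le
    (div_pos (by positivity) (by exact_mod_cast Nat.card_pos)) hu)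
  exact ⟨u, hp, hu.trans (dens_mono fun p hp => hp.2)⟩

theorem exists_increment {β I J K : Type} [Finite β] [Finite I] [Finite J] [Finite K] [Nonempty β]
    {A : Set (I ⊕ J → Option β)} (hline : ¬ HasLine A) {s ρ θ η c : ℝ}
    (hρ : 0 ≤ ρ) (hA : ∀ x : I → Option β, s ≤ dens {y | Sum.elim x y ∈ A})
    {u : K → Option β} (hθ : θ ≤
      dens {p : (I → β ⊕ K) × (J → Option β) | ∀ b, templateEval u p.1 ∈ replaceSet A b p.2})
    (hη : dens {v : I → β ⊕ K | ∀ i, templateEval u v i ≠ none} ≤ η)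
    (hc : Nat.card β * c < s - ρ - η + ρ * θ) :
    ∃ (b : β) (t : Finset β) (y : J → Option β), b ∉ t ∧
      c ≤ av fun v : I → β ⊕ K =>
        ((replaceSet A b y)ᶜ ∩ ⋂ b' ∈ t, replaceSet A b' y).indicator
          (fun x => A.indicator 1 (Sum.elim x y) - ρ) (templateEval u v) := by
  classical
  have := Fintype.ofFinite β
  have hne : Nonempty (I → β ⊕ K) := ⟨fun _ => Sum.inl (Classical.arbitrary β)⟩
  let f : (I → β ⊕ K) × (J → Option β) → ℝ := fun p =>
    A.indicator 1 (Sum.elim (templateEval u p.1) p.2) - ρ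
  let D : β → Set ((I → β ⊕ K) × (J → Option β)) := fun b =>
    {p | templateEval u p.1 ∈ replaceSet A b p.2}
  by_contra! hcon
  have h1 : av ((⋂ b ∈ (Finset.univ : Finset β), D b)ᶜ.indicator f) ≤
      (Finset.univ : Finset β).card * c := by
    refine av_indicator_compl_iInter_le D f (fun b t hbt => ?_) _
    rw [av_prod, av_comm]
    refine av_le_of_le fun y => le_trans (av_mono fun v => le_of_eq ?_) (hcon b t y hbt).le
    simp only [Set.indicator, f, D, Set.mem_inter_iff, Set.mem_compl_iff, Set.mem_iInter,
      Set.mem_ofPred_eq]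
  rw [Finset.card_univ, ← Nat.card_eq_fintype_card] at h1
  have h2 : s - ρ ≤ av f := by
    rw [av_prod]
    refine le_av_of_le fun v => ?_
    rw [av_sub, av_const]
    exact sub_le_sub_right (hA (templateEval u v)) ρ
  have h3 : av ((⋂ b ∈ (Finset.univ : Finset β), D b).indicator f) ≤ η - ρ * θ := by
    have hDall : (⋂ b ∈ (Finset.univ : Finset β), D b) =
        {p | ∀ b, templateEval u p.1 ∈ replaceSet A b p.2} := by
      ext p
      simp [D]
    rw [hDall]
    set E := {p : (I → β ⊕ K) × (J → Option β) | ∀ b, templateEval u p.1 ∈ replaceSet A b p.2}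
      with hE
    have h4 : av (E.indicator f) ≤ av fun p : (I → β ⊕ K) × (J → Option β) =>
        {v : I → β ⊕ K | ∀ i, templateEval u v i ≠ none}.indicator 1 p.1 - ρ * E.indicator 1 p := by
      refine av_mono fun p => ?_
      by_cases hp : p ∈ E
      · rw [Set.indicator_of_mem hp, Set.indicator_of_mem hp]
        simp only [f, Pi.one_apply, mul_one]
        refine sub_le_sub_right ?_ ρ
        by_cases hpA : Sum.elim (templateEval u p.1) p.2 ∈ A
        · rw [Set.indicator_of_mem hpA, Set.indicator_of_mem]
          · rfl
          · intro i hi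
            exact hline (hasLine_of_mem_replaceSet ⟨i, hi⟩ hpA hp)
        · rw [Set.indicator_of_notMem hpA]
          exact Set.indicator_nonneg (fun _ _ => zero_le_one) _
      · rw [Set.indicator_of_notMem hp, Set.indicator_of_notMem hp, mul_zero, sub_zero]
        exact Set.indicator_nonneg (fun _ _ => zero_le_one) _
    rw [av_sub, av_const_mul] at h4
    have h8 : (av fun p : (I → β ⊕ K) × (J → Option β) =>
        {v : I → β ⊕ K | ∀ i, templateEval u v i ≠ none}.indicator (1 : (I → β ⊕ K) → ℝ) p.1) =
        dens {v : I → β ⊕ K | ∀ i, templateEval u v i ≠ none} := by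
      rw [av_prod]
      simp only [av_const]
      rfl
    have h5 : ρ * θ ≤ ρ * av (E.indicator 1) := mul_le_mul_of_nonneg_left hθ hρ
    linarith
  have h7 : av f = av ((⋂ b ∈ (Finset.univ : Finset β), D b).indicator f) +
      av ((⋂ b ∈ (Finset.univ : Finset β), D b)ᶜ.indicator f) := by
    rw [← av_add]
    congr 1
    funext p
    exact (congrFun (Set.indicator_self_add_compl _ f) p).symm
  linarith

theorem DensityHJ.exists_density_lt {β : Type} [Finite β] [Nonempty β] (h : DensityHJ β) {d : ℝ}
    (hd : 0 < d) (hgood : ∀ γ : ℝ, 0 < γ → DensityHJAt (Option β) (d + γ)) :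
    ∃ τ : ℝ, 0 < τ ∧ DensityHJAt (Option β) (d - τ) := by
  classical
  obtain ⟨N₀, hN₀⟩ := h (d / 4) (by positivity)
  let K := Fin N₀
  have hβ : (0 : ℝ) < Nat.card β := by exact_mod_cast Nat.card_pos
  have hU : (0 : ℝ) < Nat.card (K → Option β) := by exact_mod_cast Nat.card_pos
  set θ : ℝ := d / 4 / Nat.card (K → Option β) with hθ
  have hθ0 : 0 < θ := by positivity
  set γ : ℝ := d * θ / 4 with hγ
  have hγ0 : 0 < γ := by positivity
  set ε : ℝ := min γ (d / 2) with hε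
  have hε0 : 0 < ε := lt_min hγ0 (by positivity)
  set c : ℝ := γ / (2 * Nat.card β) with hc
  have hc0 : 0 < c := by positivity
  obtain ⟨m, hm⟩ := hgood γ hγ0
  choose P hP using fun s : Finset β => h.av_iInter_insensitive_le m s (c / 4) (by positivity)
  obtain ⟨M', hM'⟩ := exists_forall_le P
  choose M₁ hM₁ using fun j : K =>
    exists_resample (letterOrPos_injective (β := β) j) hc0 M'
  have := Fintype.ofFinite β
  choose M₂ hM₂ using fun j : K =>
    exists_av_prod_lt (avoidWeight_nonneg (β := β) j) (av_avoidWeight_lt j) hγ0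
  obtain ⟨M₁', hM₁'⟩ := exists_forall_le M₁
  obtain ⟨M₂', hM₂'⟩ := exists_forall_le M₂
  let I := Fin (max M₁' M₂')
  set n : ℝ := (Nat.card (I → Option β) : ℝ) with hn
  have hn0 : 0 < n := by
    rw [hn]
    exact_mod_cast Nat.card_pos (α := I → Option β)
  set τ : ℝ := ε / (2 * n) with hτ
  have hτ0 : 0 < τ := by positivity
  obtain ⟨N₂, hN₂⟩ := hgood τ hτ0
  refine ⟨τ, hτ0, max M₁' M₂' + N₂, fun ι _ hι A hA => ?_⟩
  obtain ⟨r, hr, ⟨e⟩⟩ := exists_equiv_sum (ι := ι) (M := max M₁' M₂') (by omega)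
  refine HasLine.of_preimage (isProper_reindex (Option β) e) ?_
  rw [← dens_reindex e A] at hA
  set B := subspaceEval (subspaceReindex (Option β) e) ⁻¹' A with hB
  let J := Fin r
  by_contra hline
  have hsec : ∀ x : I → Option β, dens {y : J → Option β | Sum.elim x y ∈ B} ≤ d + τ := by
    intro x
    by_contra! hlt
    refine hline (HasLine.of_preimage (isProper_fix J x) (hN₂ J (by simp [J]; omega) _ ?_))
    simpa only [Set.preimage, subspaceEval_fix] using hlt.le
  have hsec' : ∀ x : I → Option β, d - ε ≤ dens {y : J → Option β | Sum.elim x y ∈ B} := by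
    intro x
    have h1 := le_av_single (f := fun x : I → Option β => d + τ -
      dens {y : J → Option β | Sum.elim x y ∈ B}) (fun x => by linarith [hsec x]) x
    have h2 : dens B = av fun x : I → Option β => dens {y : J → Option β | Sum.elim x y ∈ B} := by
      rw [dens, av_sumElim]
      rfl
    rw [av_sub, av_const, ← h2, div_le_iff₀ hn0] at h1
    have h3 : τ * n = ε / 2 := by rw [hτ]; field_simp
    nlinarith
  obtain ⟨u, ⟨j, hj⟩, hu⟩ := exists_dense_template (K := K) (hN₀ K (by simp [K])) hd (A := B)
    fun x => le_trans (by linarith [min_le_right γ (d / 2)]) (hsec' x)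
  have hη : dens {v : I → β ⊕ K | ∀ i, templateEval u v i ≠ none} ≤ γ := by
    refine (av_mono fun v => ?_).trans (hM₂ j I ((hM₂' j).trans (by simp [I]))).le
    by_cases hv : ∀ i, templateEval u v i ≠ none
    · rw [Set.indicator_of_mem (by exact hv)]
      exact one_le_prod_avoidWeight hj hv
    · rw [Set.indicator_of_notMem (by exact hv)]
      exact Finset.prod_nonneg fun i _ => avoidWeight_nonneg _ _
  have hθ1 : θ ≤ 1 := hu.trans (dens_le_one _)
  obtain ⟨b, t, y, hbt, hav⟩ := exists_increment (c := c) (ρ := d + γ) hline (by positivity) hsec'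
    hu hη (by
      have h1 : Nat.card β * c = γ / 2 := by rw [hc]; field_simp
      rw [h1]
      have h2 : ε ≤ γ := min_le_left _ _
      have h3 : d * θ = 4 * γ := by rw [hγ]; ring
      have h4 : 0 < γ * θ := by positivity
      nlinarith)
  have hF1 : ∀ x : I → Option β, B.indicator 1 (Sum.elim x y) - (d + γ) ≤ 1 := fun x => by
    have := indicator_one_le B (Sum.elim x y)
    linarith
  obtain ⟨v, hv, hav'⟩ := hM₁ j I ((hM₁' j).trans (by simp [I])) _
    (fun v => (Set.indicator_le_indicator (hF1 _)).trans (indicator_one_le _ _)) hav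
  simp only [← subspaceEval_templateSubspace hj v] at hav'
  set V := templateSubspace u j v with hV
  have key := hP (insert b t) _ ((hM' _).trans hv)
    (fun b' => subspaceEval V ⁻¹' if b' = b then (replaceSet B b y)ᶜ else replaceSet B b' y)
    (fun a => B.indicator 1 (Sum.elim (subspaceEval V a) y) - (d + γ))
    (fun b' _ => by
      refine Insensitive.preimage ?_ V
      split_ifs with hb
      · subst hb
        exact (insensitive_replaceSet B _ y).compl
      · exact insensitive_replaceSet B b' y)
    (fun a => hF1 _) fun W hW => by
      by_contra! hpos
      rw [av_sub, av_const, sub_pos] at hpos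
      have hVW : IsProper (subspaceComp (subspaceFixRight I y) (subspaceComp V W)) :=
        (isProper_fixRight I y).comp ((isProper_templateSubspace u j v).comp hW)
      refine hline (HasLine.of_preimage hVW (hm (Fin m) (by simp) _ ?_))
      simp only [dens, Set.preimage, subspaceEval_comp, subspaceEval_fixRight]
      exact hpos.le
  have heq : (fun a => ((replaceSet B b y)ᶜ ∩ ⋂ b' ∈ t, replaceSet B b' y).indicator
      (fun x => B.indicator 1 (Sum.elim x y) - (d + γ)) (subspaceEval V a)) =
      (⋂ b' ∈ insert b t, subspaceEval V ⁻¹' if b' = b then (replaceSet B b y)ᶜ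
        else replaceSet B b' y).indicator
          (fun a => B.indicator 1 (Sum.elim (subspaceEval V a) y) - (d + γ)) := by
    funext a
    have hiff : subspaceEval V a ∈ (replaceSet B b y)ᶜ ∩ ⋂ b' ∈ t, replaceSet B b' y ↔
        a ∈ ⋂ b' ∈ insert b t, subspaceEval V ⁻¹' if b' = b then (replaceSet B b y)ᶜ
          else replaceSet B b' y := by
      rw [Finset.set_biInter_insert]
      simp only [if_true, Set.mem_inter_iff, Set.mem_iInter, Set.mem_preimage]
      refine and_congr_right fun _ => forall₂_congr fun b' hb' => ?_
      have hne : b' ≠ b := fun h => hbt (h ▸ hb')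
      rw [if_neg hne]
    by_cases hx : subspaceEval V a ∈ (replaceSet B b y)ᶜ ∩ ⋂ b' ∈ t, replaceSet B b' y
    · rw [Set.indicator_of_mem hx, Set.indicator_of_mem (hiff.1 hx)]
    · rw [Set.indicator_of_notMem hx, Set.indicator_of_notMem (mt hiff.2 hx)]
  rw [heq] at hav'
  linarith

theorem DensityHJ.option {β : Type} [Finite β] (h : DensityHJ β) : DensityHJ (Option β) := by
  rcases isEmpty_or_nonempty β with hβ | hβ
  · intro δ hδ
    refine ⟨1, fun ι _ hι A hA => ?_⟩
    have : Nonempty ι := (Nat.card_pos_iff.mp (by omega)).1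
    obtain ⟨x, hx⟩ := nonempty_of_dens_pos (hδ.trans_le hA)
    exact ⟨fun _ => none, ⟨Classical.arbitrary ι, rfl⟩, fun a => by
      convert hx
      exact Subsingleton.elim _ _⟩
  set S : Set ℝ := {δ | DensityHJAt (Option β) δ} with hS
  have hup : ∀ δ ∈ S, ∀ δ', δ ≤ δ' → δ' ∈ S := fun δ ⟨N, hN⟩ δ' hle =>
    ⟨N, fun ι _ hι A hA => hN ι hι A (hle.trans hA)⟩
  have hpos : ∀ δ ∈ S, 0 ≤ δ := by
    rintro δ ⟨N, hN⟩
    by_contra! hneg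
    obtain ⟨u, -, hu⟩ := hN (Fin N) (by simp) ∅ (hneg.le.trans (dens_nonneg _))
    exact hu none
  have hbdd : BddBelow S := ⟨0, hpos⟩
  have hne : S.Nonempty := ⟨2, 0, fun ι _ _ A hA => by linarith [dens_le_one A]⟩
  have hlt : ∀ δ, sInf S < δ → δ ∈ S := fun δ hδ => by
    obtain ⟨δ', hδ', hlt⟩ := (csInf_lt_iff hbdd hne).1 hδ
    exact hup δ' hδ' δ hlt.le
  have h0 : sInf S ≤ 0 := by
    by_contra! hd
    obtain ⟨τ, hτ, hτS⟩ := h.exists_density_lt hd fun γ hγ => hlt _ (by linarith)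
    have := csInf_le hbdd hτS
    linarith
  exact fun δ hδ => hlt δ (h0.trans_lt hδ)

/-- The density Hales–Jewett theorem. -/
theorem densityHJ (α : Type) [Finite α] : DensityHJ α := by
  have := Fintype.ofFinite α
  refine Finite.induction_empty_option (P := fun α => Finite α → DensityHJ α) ?_ ?_ ?_ α ‹_›
  · exact fun {α β} e h hβ => have := Finite.of_equiv β e.symm; (h this).of_equiv e
  · exact fun _ => densityHJ_of_isEmpty _
  · exact fun {α} _ h _ => (h inferInstance).option

/-- The monomial in commuting transformations attached to a letter; `none` is the identity. -/
def letterMonomial {κ : Type} [DecidableEq κ] (a : Option κ) : κ → Multiplicative ℕ :=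
  a.elim 1 fun i => Pi.mulSingle i (Multiplicative.ofAdd 1)

theorem prod_letterMonomial_getD {κ J : Type} [DecidableEq κ] [Fintype J] (u : J → Option (Option κ))
    (a : Option κ) : ∏ j, letterMonomial ((u j).getD a) =
      letterMonomial a ^ Nat.card {j // u j = none} * ∏ j, (u j).elim 1 letterMonomial := by
  classical
  have h1 : ∀ j, letterMonomial ((u j).getD a) =
      (if u j = none then letterMonomial a else 1) * (u j).elim 1 letterMonomial := by
    intro j
    cases h : u j <;> simp
  simp only [h1]
  rw [Finset.prod_mul_distrib, Finset.prod_ite]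
  simp [Nat.card_eq_fintype_card, Fintype.card_subtype]

theorem exists_monomialHom {M κ : Type*} [Monoid M] [Fintype κ] [DecidableEq κ] {T : κ → M}
    (hT : ∀ i j, Commute (T i) (T j)) : ∃ Φ : (κ → Multiplicative ℕ) →* M,
      ∀ i, Φ (Pi.mulSingle i (Multiplicative.ofAdd 1)) = T i := by
  have h : Pairwise fun i j => ∀ a b, Commute (powersHom M (T i) a) (powersHom M (T j) b) := by
    intro i j _ a b
    rw [powersHom_apply, powersHom_apply]
    exact (hT i j).pow_pow _ _
  refine ⟨MonoidHom.noncommPiCoprod (fun i => powersHom M (T i)) h, fun i => ?_⟩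
  rw [MonoidHom.noncommPiCoprod_mulSingle, powersHom_apply, toAdd_ofAdd, pow_one]

/-- A combinatorial form of the Furstenberg–Katznelson multiple recurrence theorem. -/
theorem exists_multiple_return {X κ : Type} [MeasurableSpace X] [Fintype κ] {μ : Measure X}
    [IsProbabilityMeasure μ] {T : κ → X → X} (hT : ∀ i, MeasurePreserving (T i) μ μ)
    (hcomm : ∀ i j, T i ∘ T j = T j ∘ T i) {B : Set X} (hB : MeasurableSet B) (hpos : 0 < μ B) :
    ∃ n : ℕ, 1 ≤ n ∧ ∃ x ∈ B, ∀ i, (T i)^[n] x ∈ B := by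
  classical
  have hBr : 0 < μ.real B := ENNReal.toReal_pos hpos.ne' (measure_ne_top μ B)
  obtain ⟨N, hN⟩ := densityHJ (Option κ) (μ.real B / 2) (by positivity)
  let T' : κ → Function.End X := T
  have hT' : ∀ i j, Commute (T' i) (T' j) := fun i j => hcomm i j
  obtain ⟨Φ, hΦ₁⟩ := exists_monomialHom hT'
  have hΦ : ∀ i (n : ℕ), Φ (letterMonomial (some i) ^ n) = (T i)^[n] := by
    intro i n
    rw [map_pow]
    have : Φ (letterMonomial (some i)) = T' i := hΦ₁ i
    rw [this]
    induction n with
    | zero => rfl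
    | succ n ih =>
      rw [pow_succ, ih]
      rfl
  let S : (Fin N → Option κ) → X → X := fun w => Φ (∏ j, letterMonomial (w j))
  have hS : ∀ w, MeasurePreserving (S w) μ μ := by
    intro w
    refine Finset.prod_induction _ (fun c => MeasurePreserving (Φ c) μ μ) (fun a b ha hb => ?_) ?_
      fun j _ => ?_
    · rw [map_mul]
      exact ha.comp hb
    · rw [map_one]
      exact MeasurePreserving.id μ
    · cases h : w j with
      | none =>
        simp only [letterMonomial, Option.elim_none, map_one]
        exact MeasurePreserving.id μ
      | some i =>
        have := hΦ i 1
        rw [pow_one] at this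
        rw [this]
        exact hT i
  by_contra! hcon
  have hlt : ∀ x, dens {w | S w x ∈ B} ≤ μ.real B / 2 := by
    intro x
    by_contra! hgt
    obtain ⟨u, ⟨j, hj⟩, hu⟩ := hN (Fin N) (by simp) _ hgt.le
    have hS' : ∀ a, S (fun j => (u j).getD a) x =
        Φ (letterMonomial a ^ Nat.card {j // u j = none}) (Φ (∏ j, (u j).elim 1 letterMonomial) x) := by
      intro a
      simp only [S, prod_letterMonomial_getD, map_mul]
      rfl
    have h0 := hu none
    rw [Set.mem_ofPred_eq, hS'] at h0
    simp only [letterMonomial, Option.elim_none, one_pow, map_one] at h0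
    obtain ⟨i, hi⟩ := hcon (Nat.card {j // u j = none}) (Nat.card_pos_iff.2 ⟨⟨j, hj⟩, inferInstance⟩) _ h0
    refine hi ?_
    have h1 := hu (some i)
    rw [Set.mem_ofPred_eq, hS', hΦ] at h1
    exact h1
  have hint : ∀ w, Integrable ((S w ⁻¹' B).indicator (1 : X → ℝ)) μ := fun w =>
    (integrable_const (1 : ℝ)).indicator ((hS w).measurable hB)
  have hdens : ∀ x, dens {w | S w x ∈ B} =
      (∑ w, (S w ⁻¹' B).indicator (1 : X → ℝ) x) / Fintype.card (Fin N → Option κ) := by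
    intro x
    rw [dens, av_eq_sum]
    rfl
  have h1 : ∫ x, dens {w | S w x ∈ B} ∂μ = μ.real B := by
    simp only [hdens]
    rw [integral_div, integral_finsetSum _ fun w _ => hint w]
    have : ∀ w, ∫ x, (S w ⁻¹' B).indicator (1 : X → ℝ) x ∂μ = μ.real B := by
      intro w
      rw [integral_indicator_one ((hS w).measurable hB), measureReal_def, measureReal_def,
        (hS w).measure_preimage hB.nullMeasurableSet]
    simp only [this, Finset.sum_const, Finset.card_univ, nsmul_eq_mul]
    rw [mul_div_cancel_left₀]
    exact_mod_cast Fintype.card_ne_zero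
  have h2 : ∫ x, dens {w | S w x ∈ B} ∂μ ≤ ∫ _x, μ.real B / 2 ∂μ := by
    refine integral_mono ?_ (integrable_const _) hlt
    simp only [hdens]
    exact (integrable_finsetSum _ fun w _ => hint w).div_const _
  rw [h1, integral_const, probReal_univ, one_smul] at h2
  linarith

/-- The points of `P` that do not return simultaneously to `P` form a null set. -/
theorem measure_nonreturning_eq_zero {X κ : Type} [MeasurableSpace X] [Fintype κ] {μ : Measure X}
    [IsProbabilityMeasure μ] {T : κ → X → X} (hT : ∀ i, MeasurePreserving (T i) μ μ)
    (hcomm : ∀ i j, T i ∘ T j = T j ∘ T i) {P : Set X} (hP : MeasurableSet P) :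
    μ {x | x ∈ P ∧ ∀ n : ℕ, 1 ≤ n → ∃ i, (T i)^[n] x ∉ P} = 0 := by
  have hmeas : MeasurableSet {x | x ∈ P ∧ ∀ n : ℕ, 1 ≤ n → ∃ i, (T i)^[n] x ∉ P} := by
    have : {x | x ∈ P ∧ ∀ n : ℕ, 1 ≤ n → ∃ i, (T i)^[n] x ∉ P} =
        P ∩ ⋂ n : ℕ, ⋂ _ : 1 ≤ n, ⋃ i, ((T i)^[n] ⁻¹' P)ᶜ := by
      ext x
      simp
    rw [this]
    exact hP.inter <| MeasurableSet.iInter fun n => MeasurableSet.iInter fun _ => MeasurableSet.iUnion fun i =>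
      ((hT i).measurable.iterate n hP).compl
  by_contra hne
  obtain ⟨n, hn, x, hx, hxT⟩ := exists_multiple_return hT hcomm hmeas (pos_iff_ne_zero.2 hne)
  obtain ⟨i, hi⟩ := hx.2 n hn
  exact hi (hxT i).1

theorem prefixList_eq_map (Z : ℕ → Bool) (n : ℕ) : prefixList Z n = (List.range n).map Z := by
  unfold prefixList
  apply List.ext_getElem <;> simp

@[simp] theorem length_prefixList (Z : ℕ → Bool) (n : ℕ) : (prefixList Z n).length = n := by
  simp [prefixList]

theorem isPrefixOf_iff (σ : List Bool) (Z : ℕ → Bool) :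
    IsPrefixOf σ Z ↔ prefixList Z σ.length = σ := by
  rw [prefixList_eq_map]
  constructor
  · intro h
    apply List.ext_getElem
    · simp
    · intro i h1 h2
      simp only [List.getElem_map, List.getElem_range]
      rw [← h i h2, List.getD_eq_getElem _ _ h2]
  · intro h i hi
    rw [List.getD_eq_getElem _ _ hi]
    conv_lhs => rw [← List.getElem_of_eq h (by simpa using hi)]
    simp

/-- The first `n` bits of `σ`, padded with zeros. -/
def padTo (n : ℕ) (σ : List Bool) : List Bool := (List.range n).map (fun i => σ.getD i false)

theorem padTo_prefixList {n m : ℕ} (h : n ≤ m) (Z : ℕ → Bool) :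
    padTo n (prefixList Z m) = prefixList Z n := by
  rw [prefixList_eq_map, prefixList_eq_map, padTo]
  apply List.map_congr_left
  intro i hi
  have hi : i < m := lt_of_lt_of_le (List.mem_range.1 hi) h
  simp [List.getD_eq_getElem?_getD, hi]

theorem prefixList_isPrefix {n m : ℕ} (h : n ≤ m) (Z : ℕ → Bool) :
    prefixList Z n <+: prefixList Z m := by
  rw [prefixList_eq_map, prefixList_eq_map]
  refine List.IsPrefix.map _ ?_
  refine ⟨(List.range (m - n)).map (n + ·), ?_⟩
  rw [← List.range_add]
  congr 1; omega

theorem IsPrefixOf.padTo_eq {ρ : List Bool} {Z : ℕ → Bool} (h : IsPrefixOf ρ Z) {n : ℕ}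
    (hn : n ≤ ρ.length) : padTo n ρ = prefixList Z n := by
  rw [isPrefixOf_iff] at h
  rw [← h, padTo_prefixList hn]

theorem isPrefixOf_prefixList (Z : ℕ → Bool) (n : ℕ) : IsPrefixOf (prefixList Z n) Z := by
  rw [isPrefixOf_iff, length_prefixList]

/-- The `c`-th binary string of length `n`. -/
def bitString (n c : ℕ) : List Bool := (List.range n).map (fun j => c.testBit j)

@[simp] theorem length_bitString (n c : ℕ) : (bitString n c).length = n := by simp [bitString]

theorem exists_bitString_eq (Z : ℕ → Bool) (n : ℕ) :
    ∃ c < 2 ^ n, bitString n c = prefixList Z n := by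
  refine ⟨Nat.ofBits (fun i : Fin n => Z i), Nat.ofBits_lt_two_pow _, ?_⟩
  rw [prefixList_eq_map, bitString]
  apply List.map_congr_left
  intro i hi
  have hi : i < n := List.mem_range.1 hi
  rw [Nat.testBit_ofBits_lt _ _ hi]

theorem bitString_injOn {n c d : ℕ} (hc : c < 2 ^ n) (hd : d < 2 ^ n)
    (h : bitString n c = bitString n d) : c = d := by
  apply Nat.eq_of_testBit_eq
  intro i
  by_cases hi : i < n
  · have := List.getElem_of_eq h (i := i) (by simpa using hi)
    simpa [bitString] using this
  · have hp : 2 ^ n ≤ 2 ^ i := Nat.pow_le_pow_right (by norm_num) (by omega)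
    rw [Nat.testBit_lt_two_pow (hc.trans_le hp), Nat.testBit_lt_two_pow (hd.trans_le hp)]

/-- The clopen set of sequences whose prefix of length `n` satisfies `φ`. -/
def cylSet (n : ℕ) (φ : List Bool → Bool) : Set (ℕ → Bool) := {Z | φ (prefixList Z n) = true}

theorem measurableSet_prefixList_preimage (n : ℕ) (s : Set (List Bool)) :
    MeasurableSet ((fun Z : ℕ → Bool => prefixList Z n) ⁻¹' s) := by
  have h : (fun Z : ℕ → Bool => prefixList Z n) =
      (fun f : Fin n → Bool => List.ofFn f) ∘ (fun Z i => Z i) := rfl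
  rw [h, Set.preimage_comp]
  have hm : Measurable fun (Z : ℕ → Bool) (i : Fin n) => Z i :=
    measurable_pi_lambda _ fun i => measurable_pi_apply _
  exact hm (Set.toFinite _).measurableSet

theorem measurableSet_cylSet (n : ℕ) (φ : List Bool → Bool) : MeasurableSet (cylSet n φ) :=
  measurableSet_prefixList_preimage n {σ | φ σ = true}

theorem isPrefixOf_setOf (σ : List Bool) :
    {Z | IsPrefixOf σ Z} = cylSet σ.length (fun τ => decide (τ = σ)) := by
  ext Z
  simp [cylSet, isPrefixOf_iff]

theorem IsUniformMeasure.isProbabilityMeasure {μ : Measure (ℕ → Bool)} (hμ : IsUniformMeasure μ) :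
    IsProbabilityMeasure μ := by
  constructor
  have := hμ []
  simpa [IsPrefixOf] using this

/-- The number of strings of length `n` satisfying `φ`. -/
def countStrings (n : ℕ) (φ : List Bool → Bool) : ℕ :=
  Nat.count (fun c => φ (bitString n c) = true) (2 ^ n)

theorem IsUniformMeasure.measure_cylSet {μ : Measure (ℕ → Bool)} (hμ : IsUniformMeasure μ)
    (n : ℕ) (φ : List Bool → Bool) :
    μ (cylSet n φ) = (countStrings n φ : ENNReal) * 2⁻¹ ^ n := by
  have h1 : cylSet n φ = ⋃ c ∈ (Finset.range (2 ^ n)).filter (fun c => φ (bitString n c) = true),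
      {Z | IsPrefixOf (bitString n c) Z} := by
    ext Z
    simp only [cylSet, Set.mem_ofPred_eq, Finset.mem_filter, Finset.mem_range, Set.mem_iUnion,
      isPrefixOf_iff, length_bitString, exists_prop]
    constructor
    · intro h
      obtain ⟨c, hc, he⟩ := exists_bitString_eq Z n
      exact ⟨c, ⟨hc, he ▸ h⟩, he.symm⟩
    · rintro ⟨c, ⟨_, h⟩, he⟩
      rwa [he]
  rw [h1, measure_biUnion_finset]
  · simp only [hμ _, length_bitString, Finset.sum_const, nsmul_eq_mul]
    rw [countStrings, Nat.count_eq_card_filter_range]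
  · intro c hc d hd hcd
    refine Set.disjoint_left.2 fun Z hZ hZ' => hcd ?_
    simp only [Finset.coe_filter, Finset.mem_range, Set.mem_ofPred_eq, isPrefixOf_iff,
      length_bitString] at hc hd hZ hZ'
    exact bitString_injOn hc.1 hd.1 (hZ.symm.trans hZ')
  · intro c _
    rw [isPrefixOf_setOf]
    exact measurableSet_cylSet _ _

theorem IsUniformMeasure.measureReal_cylSet {μ : Measure (ℕ → Bool)} (hμ : IsUniformMeasure μ)
    (n : ℕ) (φ : List Bool → Bool) :
    (μ (cylSet n φ)).toReal = (countStrings n φ : ℝ) / 2 ^ n := by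
  rw [hμ.measure_cylSet]
  simp [div_eq_mul_inv]

/-- Bounded existential quantifier with values in `Bool`. -/
def existsLT (n : ℕ) (p : ℕ → Bool) : Bool := Nat.rec false (fun c b => b || p c) n

/-- Bounded universal quantifier with values in `Bool`. -/
def forallLT (n : ℕ) (p : ℕ → Bool) : Bool := Nat.rec true (fun c b => b && p c) n

theorem existsLT_eq_true {n : ℕ} {p : ℕ → Bool} : existsLT n p = true ↔ ∃ c < n, p c = true := by
  induction n with
  | zero => simp [existsLT]
  | succ n ih =>
    have : existsLT (n + 1) p = (existsLT n p || p n) := rfl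
    rw [this, Bool.or_eq_true, ih]
    simp only [Nat.lt_succ_iff_lt_or_eq]
    constructor
    · rintro (⟨c, h, h'⟩ | h)
      exacts [⟨c, Or.inl h, h'⟩, ⟨n, Or.inr rfl, h⟩]
    · rintro ⟨c, h | rfl, h'⟩
      exacts [Or.inl ⟨c, h, h'⟩, Or.inr h']

theorem forallLT_eq_true {n : ℕ} {p : ℕ → Bool} : forallLT n p = true ↔ ∀ c < n, p c = true := by
  induction n with
  | zero => simp [forallLT]
  | succ n ih =>
    have : forallLT (n + 1) p = (forallLT n p && p n) := rfl
    rw [this, Bool.and_eq_true, ih]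
    simp only [Nat.lt_succ_iff_lt_or_eq]
    constructor
    · rintro ⟨h, h'⟩ c (hc | rfl)
      exacts [h c hc, h']
    · intro h
      exact ⟨fun c hc => h c (Or.inl hc), h n (Or.inr rfl)⟩

section Computability

variable {α β γ : Type} [Primcodable α] [Primcodable β] [Primcodable γ]

theorem computable_and : Computable₂ (fun a b : Bool => a && b) := Primrec.and.to_comp
theorem computable_or : Computable₂ (fun a b : Bool => a || b) := Primrec.or.to_comp
theorem computable_not : Computable (fun a : Bool => !a) := Primrec.not.to_comp
theorem computable_add : Computable₂ (fun a b : ℕ => a + b) := Primrec.nat_add.to_comp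
theorem computable_mul : Computable₂ (fun a b : ℕ => a * b) := Primrec.nat_mul.to_comp
theorem computable_div : Computable₂ (fun a b : ℕ => a / b) := Primrec.nat_div.to_comp
theorem computable_mod : Computable₂ (fun a b : ℕ => a % b) := Primrec.nat_mod.to_comp
theorem computable_le : Computable₂ (fun a b : ℕ => decide (a ≤ b)) :=
  Primrec.nat_le.decide.to_comp
theorem computable_lt : Computable₂ (fun a b : ℕ => decide (a < b)) :=
  Primrec.nat_lt.decide.to_comp
theorem computable_beq [DecidableEq β] : Computable₂ (fun a b : β => decide (a = b)) :=
  Primrec.eq.decide.to_comp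

theorem computable_existsLT {φ : α → ℕ → Bool} (hφ : Computable₂ φ) {b : α → ℕ}
    (hb : Computable b) : Computable fun a => existsLT (b a) (φ a) := by
  refine Computable.nat_rec hb (Computable.const false)
    (h := fun a p => p.2 || φ a p.1) ?_
  exact computable_or.comp (Computable.snd.comp Computable.snd)
    (hφ.comp Computable.fst (Computable.fst.comp Computable.snd))

theorem computable_forallLT {φ : α → ℕ → Bool} (hφ : Computable₂ φ) {b : α → ℕ}
    (hb : Computable b) : Computable fun a => forallLT (b a) (φ a) := by
  refine Computable.nat_rec hb (Computable.const true)
    (h := fun a p => p.2 && φ a p.1) ?_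
  exact computable_and.comp (Computable.snd.comp Computable.snd)
    (hφ.comp Computable.fst (Computable.fst.comp Computable.snd))

theorem computable_count {φ : α → ℕ → Bool} (hφ : Computable₂ φ) {b : α → ℕ}
    (hb : Computable b) : Computable fun a => Nat.count (fun c => φ a c = true) (b a) := by
  have h := Computable.nat_rec hb (Computable.const 0)
    (h := fun a (p : ℕ × ℕ) => p.2 + bif φ a p.1 then 1 else 0) ?_
  · refine h.of_eq fun a => ?_
    induction b a with
    | zero => rfl
    | succ n ih =>
      rw [Nat.count_succ, ← ih]
      cases h : φ a n <;> simp [h]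
  · exact computable_add.comp (Computable.snd.comp Computable.snd)
      (Computable.cond (hφ.comp Computable.fst (Computable.fst.comp Computable.snd))
        (Computable.const 1) (Computable.const 0))

theorem computable_pow_two : Computable fun n : ℕ => 2 ^ n := by
  have h := Computable.nat_rec (f := fun n : ℕ => n) Computable.id (Computable.const 1)
    (h := fun _ (p : ℕ × ℕ) => p.2 * 2)
    (computable_mul.comp (Computable.snd.comp Computable.snd) (Computable.const 2))
  refine h.of_eq fun n => ?_
  induction n with
  | zero => rfl
  | succ n ih => rw [pow_succ, ← ih]

theorem primrec_pow_two : Primrec fun n : ℕ => 2 ^ n := by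
  have h := Primrec.nat_rec' (f := fun n : ℕ => n) Primrec.id (Primrec.const 1)
    (h := fun _ (p : ℕ × ℕ) => p.2 * 2)
    (Primrec.nat_mul.comp (Primrec.snd.comp Primrec.snd) (Primrec.const 2))
  refine h.of_eq fun n => ?_
  induction n with
  | zero => rfl
  | succ n ih => rw [pow_succ, ← ih]

theorem primrec_testBit : Primrec₂ fun c j : ℕ => c.testBit j := by
  have h : Primrec₂ fun c j : ℕ => decide (c / 2 ^ j % 2 = 1) :=
    Primrec.eq.decide.comp (Primrec.nat_mod.comp
      (Primrec.nat_div.comp Primrec.fst (primrec_pow_two.comp Primrec.snd)) (Primrec.const 2))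
      (Primrec.const 1)
  refine h.of_eq fun c j => ?_
  rw [Nat.testBit_eq_decide_div_mod_eq]

theorem computable_bitString : Computable₂ bitString := by
  refine Primrec.to_comp ?_
  exact Primrec.list_map (Primrec.list_range.comp Primrec.fst)
    (primrec_testBit.comp (Primrec.snd.comp Primrec.fst) Primrec.snd)

theorem computable_padTo : Computable₂ padTo := by
  refine Primrec.to_comp ?_
  exact Primrec.list_map (Primrec.list_range.comp Primrec.fst)
    ((Primrec.list_getD false).comp (Primrec.snd.comp Primrec.fst) Primrec.snd)

theorem computable_countStrings {φ : α → List Bool → Bool} (hφ : Computable₂ φ) {b : α → ℕ}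
    (hb : Computable b) : Computable fun a => countStrings (b a) (φ a) := by
  refine computable_count (φ := fun a c => φ a (bitString (b a) c)) ?_ (computable_pow_two.comp hb)
  exact hφ.comp Computable.fst
    (computable_bitString.comp (hb.comp Computable.fst) Computable.snd)

theorem exists_computable_search {φ : α → ℕ → Bool} (hφ : Computable₂ φ)
    (h : ∀ a, ∃ n, φ a n = true) : ∃ s : α → ℕ, Computable s ∧ ∀ a, φ a (s a) = true := by
  refine ⟨fun a => Nat.find (h a), ?_, fun a => Nat.find_spec (h a)⟩
  refine Partrec.of_eq_tot (f := fun a => Nat.rfind fun n => Part.some (φ a n)) ?_ ?_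
  · exact Partrec.rfind hφ.partrec₂
  · intro a
    refine Nat.mem_rfind.2 ⟨?_, fun {m} hm => ?_⟩
    · simpa using Nat.find_spec (h a)
    · have := Nat.find_min (h a) hm
      simpa using this

theorem exists_computable₂_of_fin (k : ℕ) (f : Fin k → List Bool → List Bool)
    (hf : ∀ i, Computable (f i)) :
    ∃ F : ℕ → List Bool → List Bool, Computable₂ F ∧ ∀ i : Fin k, F i = f i := by
  induction k with
  | zero => exact ⟨fun _ σ => σ, Computable.snd, fun i => i.elim0⟩
  | succ k ih =>
    obtain ⟨F, hF, h⟩ := ih (fun i => f i.castSucc) (fun i => hf _)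
    refine ⟨fun i σ => bif decide (i < k) then F i σ else f (Fin.last k) σ, ?_, fun i => ?_⟩
    · exact Computable.cond (computable_lt.comp Computable.fst (Computable.const k)) hF
        ((hf _).comp Computable.snd)
    · refine Fin.lastCases ?_ (fun i => ?_) i
      · simp
      · funext σ
        simp [← h]

theorem computable_iterate {F : α → β → β} (hF : Computable₂ F) {a : γ → α} {n : γ → ℕ}
    {b : γ → β} (ha : Computable a) (hn : Computable n) (hb : Computable b) :
    Computable fun x => (F (a x))^[n x] (b x) := by
  have h := Computable.nat_rec hn hb (h := fun x (q : ℕ × β) => F (a x) q.2)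
    (hF.comp (ha.comp Computable.fst) (Computable.snd.comp Computable.snd))
  refine h.of_eq fun x => ?_
  induction n x with
  | zero => rfl
  | succ n ih => rw [Function.iterate_succ_apply', ← ih]

end Computability

/-- The numerical code of a rational underlying its `Encodable` instance. -/
def ratCode (q : ℚ) : ℕ := @Encodable.encode ℚ Rat.instEncodable q

theorem encode_int_ofNat (n : ℕ) : Encodable.encode (n : ℤ) = 2 * n := rfl
theorem encode_int_negSucc (n : ℕ) : Encodable.encode (Int.negSucc n) = 2 * n + 1 := rfl

theorem ratCode_eq (q : ℚ) : ratCode q = Nat.pair (Encodable.encode q.num) q.den := rfl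

theorem natAbs_eq_encode (n : ℤ) : n.natAbs = (Encodable.encode n + 1) / 2 := by
  rcases n with n | n
  · have := encode_int_ofNat n
    simp only [Int.ofNat_eq_natCast, this, Int.natAbs_natCast]; omega
  · rw [encode_int_negSucc, Int.natAbs_negSucc]; omega

/-- A decision procedure for being the code of a rational. -/
def isRatCode (m : ℕ) : Bool :=
  decide (0 < m.unpair.2) && forallLT (m.unpair.2 + 1) fun d =>
    decide (d ≤ 1) || !(decide ((m.unpair.1 + 1) / 2 % d = 0) && decide (m.unpair.2 % d = 0))

theorem isRatCode_eq_true {m : ℕ} :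
    isRatCode m = true ↔ 0 < m.unpair.2 ∧ ((m.unpair.1 + 1) / 2).Coprime m.unpair.2 := by
  simp only [isRatCode, Bool.and_eq_true, decide_eq_true_eq, forallLT_eq_true, Bool.or_eq_true,
    Bool.not_eq_true', Bool.and_eq_false_iff, decide_eq_false_iff_not]
  refine and_congr_right fun hb => ?_
  generalize (m.unpair.1 + 1) / 2 = a
  generalize m.unpair.2 = b at hb
  constructor
  · intro h
    have h1 := h (Nat.gcd a b) (Nat.lt_succ_of_le (Nat.gcd_le_right a hb))
    have ha := Nat.mod_eq_zero_of_dvd (Nat.gcd_dvd_left a b)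
    have hb' := Nat.mod_eq_zero_of_dvd (Nat.gcd_dvd_right a b)
    have := Nat.gcd_pos_of_pos_right a hb
    unfold Nat.Coprime
    rcases h1 with h1 | h1 | h1
    · omega
    · exact absurd ha h1
    · exact absurd hb' h1
  · intro h d _
    by_contra! hd
    have := Nat.dvd_gcd (Nat.dvd_of_mod_eq_zero hd.2.1) (Nat.dvd_of_mod_eq_zero hd.2.2)
    rw [h] at this
    have := Nat.le_of_dvd one_pos this
    omega

theorem isRatCode_iff_mem_range (m : ℕ) : isRatCode m = true ↔ m ∈ Set.range ratCode := by
  rw [isRatCode_eq_true]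
  constructor
  · rintro ⟨hb, hc⟩
    obtain ⟨n, hn⟩ : ∃ n : ℤ, Encodable.encode n = m.unpair.1 :=
      ⟨Equiv.intEquivNat.symm m.unpair.1, Equiv.intEquivNat.apply_symm_apply _⟩
    rw [← hn, ← natAbs_eq_encode] at hc
    refine ⟨⟨n, m.unpair.2, hb.ne', hc⟩, ?_⟩
    rw [ratCode_eq]
    simp only [hn, Nat.pair_unpair]
  · rintro ⟨q, rfl⟩
    rw [ratCode_eq, Nat.unpair_pair, ← natAbs_eq_encode]
    exact ⟨q.den_pos, q.reduced⟩

theorem ratCode_ofNat (n : ℕ) :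
    ratCode (Denumerable.ofNat ℚ n) = Nat.nth (fun m => isRatCode m = true) n := by
  have hset : Set.ofPred (fun m => isRatCode m = true) = Set.range ratCode := by
    ext m; exact isRatCode_iff_mem_range m
  have hinj : Function.Injective ratCode := @Encodable.encode_injective ℚ Rat.instEncodable
  have hinf : (Set.ofPred (fun m => isRatCode m = true)).Infinite := by
    rw [hset]; exact Set.infinite_range_of_injective hinj
  have key : ∀ (s : Set ℕ) (hs : s.Infinite), s = Set.range ratCode →
      ratCode (Denumerable.ofNat ℚ n) = (@Nat.Subtype.orderIsoOfNat s hs.to_subtype n : ℕ) := by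
    rintro s hs rfl
    have := hs.to_subtype
    rw [@Nat.Subtype.orderIsoOfNat_apply (Set.range ratCode) _
      (@Encodable.decidableRangeEncode ℚ Rat.instEncodable)]
    have h1 : Denumerable.ofNat ℚ n = (@Encodable.equivRangeEncode ℚ Rat.instEncodable).symm
        (@Nat.Subtype.ofNat (Set.range ratCode)
          (@Encodable.decidableRangeEncode ℚ Rat.instEncodable) _ n) := by
      unfold Denumerable.ofNat
      simp
      rfl
    rw [h1]
    exact congrArg Subtype.val
      ((@Encodable.equivRangeEncode ℚ Rat.instEncodable).apply_symm_apply _)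
  rw [Nat.nth_eq_orderIsoOfNat hinf]
  exact key _ hinf hset

theorem computable_isRatCode : Computable isRatCode := by
  have h1 : Computable fun m : ℕ => m.unpair.1 := Computable.fst.comp Computable.unpair
  have h2 : Computable fun m : ℕ => m.unpair.2 := Computable.snd.comp Computable.unpair
  refine computable_and.comp (computable_lt.comp (Computable.const 0) h2)
    (computable_forallLT ?_ (computable_add.comp h2 (Computable.const 1)))
  refine computable_or.comp (computable_le.comp Computable.snd (Computable.const 1))
    (computable_not.comp (computable_and.comp ?_ ?_))
  · exact computable_beq.comp (computable_mod.comp (computable_div.comp (computable_add.comp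
      (h1.comp Computable.fst) (Computable.const 1)) (Computable.const 2)) Computable.snd)
      (Computable.const 0)
  · exact computable_beq.comp (computable_mod.comp (h2.comp Computable.fst) Computable.snd)
      (Computable.const 0)

theorem computable_ratCode_ofNat : Computable fun n => ratCode (Denumerable.ofNat ℚ n) := by
  have hinf : (Set.ofPred (fun m => isRatCode m = true)).Infinite := by
    have hset : Set.ofPred (fun m => isRatCode m = true) = Set.range ratCode := by
      ext m; exact isRatCode_iff_mem_range m
    rw [hset]
    exact Set.infinite_range_of_injective (@Encodable.encode_injective ℚ Rat.instEncodable)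
  obtain ⟨s, hs, hs'⟩ := exists_computable_search (α := ℕ)
    (φ := fun n m => isRatCode m && decide (Nat.count (fun m => isRatCode m = true) m = n))
    (computable_and.comp (computable_isRatCode.comp Computable.snd)
      (computable_beq.comp (computable_count (φ := fun _ c => isRatCode c)
        (computable_isRatCode.comp Computable.snd) Computable.snd) Computable.fst))
    (fun n => ⟨Nat.nth (fun m => isRatCode m = true) n, by
      rw [Nat.count_nth_of_infinite hinf]
      simpa using Nat.nth_mem_of_infinite hinf n⟩)
  refine hs.of_eq fun n => ?_
  rw [ratCode_ofNat]
  have h := hs' n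
  rw [Bool.and_eq_true, decide_eq_true_eq] at h
  conv_rhs => rw [← h.2]
  exact (Nat.nth_count (p := fun m => isRatCode m = true) h.1).symm

theorem computable_ratCode : Computable ratCode := by
  refine (computable_ratCode_ofNat.comp (Computable.encode (α := ℚ))).of_eq fun q => ?_
  rw [Denumerable.ofNat_encode]

theorem computable_rat_den : Computable fun q : ℚ => q.den := by
  refine ((Computable.snd.comp Computable.unpair).comp computable_ratCode).of_eq fun q => ?_
  rw [ratCode_eq, Nat.unpair_pair]

theorem toNat_eq_encode (n : ℤ) : n.toNat =
    bif decide (Encodable.encode n % 2 = 0) then Encodable.encode n / 2 else 0 := by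
  rcases n with n | n
  · have := encode_int_ofNat n
    simp [this]
  · simp only [encode_int_negSucc, Int.toNat_negSucc]
    have : (2 * n + 1) % 2 = 1 := by omega
    simp [this]

theorem computable_rat_num_toNat : Computable fun q : ℚ => q.num.toNat := by
  have h1 : Computable fun q : ℚ => (ratCode q).unpair.1 :=
    (Computable.fst.comp Computable.unpair).comp computable_ratCode
  refine (Computable.cond (computable_beq.comp (computable_mod.comp h1 (Computable.const 2))
    (Computable.const 0)) (computable_div.comp h1 (Computable.const 2))
    (Computable.const 0)).of_eq fun q => ?_
  rw [toNat_eq_encode, ratCode_eq, Nat.unpair_pair]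

theorem exists_computable_rat_div :
    ∃ D : ℕ → ℕ → ℚ, Computable₂ D ∧ ∀ a b, 0 < b → D a b = (a : ℚ) / b := by
  have hq : Computable fun p : (ℕ × ℕ) × ℕ => Denumerable.ofNat ℚ p.2 :=
    (Computable.ofNat ℚ).comp Computable.snd
  have hex : ∀ p : ℕ × ℕ, ∃ n, (decide (p.2 = 0) ||
      decide ((Denumerable.ofNat ℚ n).num.toNat * p.2 = p.1 * (Denumerable.ofNat ℚ n).den)) = true := by
    rintro ⟨a, b⟩
    by_cases hb : b = 0
    · exact ⟨0, by simp [hb]⟩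
    · refine ⟨@Encodable.encode ℚ Denumerable.toEncodable ((a : ℚ) / b), ?_⟩
      rw [Denumerable.ofNat_encode]
      simp only [hb, decide_false, Bool.false_or, decide_eq_true_eq]
      have hb' : (b : ℚ) ≠ 0 := by exact_mod_cast hb
      have hnn : (0 : ℚ) ≤ (a : ℚ) / b := by positivity
      obtain ⟨q, hq⟩ : ∃ q : ℚ, q = (a : ℚ) / b := ⟨_, rfl⟩
      rw [← hq] at hnn ⊢
      have hn : ((q.num.toNat : ℤ) : ℚ) = q.num := by
        rw [Int.toNat_of_nonneg (Rat.num_nonneg.2 hnn)]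
      have hd : (q.den : ℚ) ≠ 0 := by exact_mod_cast q.den_pos.ne'
      rw [eq_div_iff hb', ← Rat.num_div_den q, ← hn, div_mul_eq_mul_div, div_eq_iff hd] at hq
      exact_mod_cast hq
  obtain ⟨s, hs, hs'⟩ := exists_computable_search (α := ℕ × ℕ)
    (φ := fun p n => decide (p.2 = 0) ||
      decide ((Denumerable.ofNat ℚ n).num.toNat * p.2 = p.1 * (Denumerable.ofNat ℚ n).den))
    (computable_or.comp (computable_beq.comp (Computable.snd.comp Computable.fst)
        (Computable.const 0))
      (computable_beq.comp
        (computable_mul.comp (computable_rat_num_toNat.comp hq)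
          (Computable.snd.comp Computable.fst))
        (computable_mul.comp (Computable.fst.comp Computable.fst) (computable_rat_den.comp hq))))
    hex
  · refine ⟨fun a b => bif decide (a = 0) then 0 else Denumerable.ofNat ℚ (s (a, b)), ?_,
      fun a b hb => ?_⟩
    · exact Computable.cond (computable_beq.comp Computable.fst (Computable.const 0))
        (Computable.const 0) ((Computable.ofNat ℚ).comp hs)
    · by_cases ha : a = 0
      · simp [ha]
      · have h := hs' (a, b)
        simp only [hb.ne', decide_false, Bool.false_or, decide_eq_true_eq] at h
        simp only [ha, decide_false, cond_false]
        generalize Denumerable.ofNat ℚ (s (a, b)) = q at h ⊢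
        have hpos : 0 < q.num.toNat * b := by
          rw [h]; exact Nat.mul_pos (Nat.pos_of_ne_zero ha) q.den_pos
        have hn : ((q.num.toNat : ℤ) : ℚ) = q.num := by
          rw [Int.toNat_of_nonneg]
          by_contra! hneg
          rw [Int.toNat_of_nonpos hneg.le] at hpos
          omega
        have hb' : (b : ℚ) ≠ 0 := by exact_mod_cast hb.ne'
        have hd : (q.den : ℚ) ≠ 0 := by exact_mod_cast q.den_pos.ne'
        rw [eq_div_iff hb']
        conv_lhs => rw [← Rat.num_div_den q]
        rw [← hn, div_mul_eq_mul_div, div_eq_iff hd]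
        exact_mod_cast h

theorem exists_computable_bound {N : ℕ → ℕ} (hN : Computable N) :
    ∃ Λ : ℕ → ℕ, Computable Λ ∧ ∀ n, ∀ l < n, N l ≤ Λ n := by
  have h := Computable.nat_rec (f := fun n : ℕ => n) Computable.id (Computable.const 0)
    (h := fun _ (p : ℕ × ℕ) => p.2 + N p.1)
    (computable_add.comp (Computable.snd.comp Computable.snd)
      (hN.comp (Computable.fst.comp Computable.snd)))
  refine ⟨_, h, fun n => ?_⟩
  induction n with
  | zero => simp
  | succ n ih =>
    intro l hl
    rcases Nat.lt_succ_iff_lt_or_eq.1 hl with hl | rfl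
    · exact (ih l hl).trans (Nat.le_add_right _ _)
    · exact Nat.le_add_left _ _

theorem tsum_inv_two_pow (m : ℕ) : ∑' i : ℕ, (2⁻¹ : ENNReal) ^ (m + 1 + i) = 2⁻¹ ^ m := by
  simp_rw [pow_add]
  rw [ENNReal.tsum_mul_left, ENNReal.tsum_geometric, ENNReal.one_sub_inv_two, inv_inv, pow_one,
    mul_assoc, ENNReal.inv_mul_cancel (by simp) (by simp), mul_one]

theorem SchnorrRandom.eventually_not_mem_cylSet {μ : Measure (ℕ → Bool)} (hμ : IsUniformMeasure μ)
    {z : ℕ → Bool} (hz : SchnorrRandom μ z) {N : ℕ → ℕ} (hN : Computable N)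
    {D : ℕ → List Bool → Bool} (hD : Computable₂ D)
    (hle : ∀ l, μ (cylSet (N l) (D l)) ≤ 2⁻¹ ^ l) :
    ∃ l₀, ∀ l ≥ l₀, z ∉ cylSet (N l) (D l) := by
  have := hμ.isProbabilityMeasure
  set f : ℕ → ℕ → Option (List Bool) := fun m n =>
    bif decide (n.unpair.2 < 2 ^ N (m + 1 + n.unpair.1)) &&
        D (m + 1 + n.unpair.1) (bitString (N (m + 1 + n.unpair.1)) n.unpair.2)
      then some (bitString (N (m + 1 + n.unpair.1)) n.unpair.2) else none with hf
  have hfc : Computable₂ f := by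
    have h1 : Computable fun p : ℕ × ℕ => p.2.unpair.1 :=
      Computable.fst.comp (Computable.unpair.comp Computable.snd)
    have h2 : Computable fun p : ℕ × ℕ => p.2.unpair.2 :=
      Computable.snd.comp (Computable.unpair.comp Computable.snd)
    have h3 : Computable fun p : ℕ × ℕ => p.1 + 1 + p.2.unpair.1 :=
      computable_add.comp (computable_add.comp Computable.fst (Computable.const 1)) h1
    have h4 := computable_bitString.comp (hN.comp h3) h2
    exact Computable.cond (computable_and.comp
      (computable_lt.comp h2 (computable_pow_two.comp (hN.comp h3))) (hD.comp h3 h4))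
      (Computable.option_some.comp h4) (Computable.const none)
  set S : ℕ → Set (List Bool) := fun m => {σ | ∃ n, f m n = some σ} with hS
  have hopen : ∀ m, openCl (S m) = ⋃ i, cylSet (N (m + 1 + i)) (D (m + 1 + i)) := by
    intro m
    ext Z
    simp only [openCl, hS, Set.mem_ofPred_eq, Set.mem_iUnion, cylSet]
    constructor
    · rintro ⟨σ, ⟨n, hn⟩, hσ⟩
      refine ⟨n.unpair.1, ?_⟩
      simp only [hf] at hn
      rw [isPrefixOf_iff] at hσ
      cases hb : (decide (n.unpair.2 < 2 ^ N (m + 1 + n.unpair.1)) &&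
        D (m + 1 + n.unpair.1) (bitString (N (m + 1 + n.unpair.1)) n.unpair.2)) with
      | false => simp [hb] at hn
      | true =>
        rw [hb] at hn
        simp only [cond_true, Option.some.injEq] at hn
        subst hn
        rw [length_bitString] at hσ
        rw [hσ]
        exact (Bool.and_eq_true _ _ ▸ hb).2
    · rintro ⟨i, hi⟩
      obtain ⟨c, hc, he⟩ := exists_bitString_eq Z (N (m + 1 + i))
      refine ⟨prefixList Z (N (m + 1 + i)), ⟨Nat.pair i c, ?_⟩, isPrefixOf_prefixList _ _⟩
      simp only [hf, Nat.unpair_pair, hc, he, hi, decide_true, Bool.and_true, cond_true]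
  have hbound : ∀ m, μ (openCl (S m)) ≤ 2⁻¹ ^ m := by
    intro m
    rw [hopen, ← tsum_inv_two_pow]
    exact (measure_iUnion_le _).trans (ENNReal.tsum_le_tsum fun i => hle _)
  obtain ⟨Λ, hΛ, hΛN⟩ := exists_computable_bound hN
  obtain ⟨Q, hQ, hQe⟩ := exists_computable_rat_div
  set E : ℕ × ℕ → List Bool → Bool := fun p σ =>
    existsLT p.2 fun i => D (p.1 + 1 + i) (padTo (N (p.1 + 1 + i)) σ) with hE
  have hEc : Computable₂ E := by
    refine computable_existsLT
      (φ := fun (p : (ℕ × ℕ) × List Bool) i => D (p.1.1 + 1 + i) (padTo (N (p.1.1 + 1 + i)) p.2))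
      ?_ (Computable.snd.comp Computable.fst)
    have h3 : Computable fun p : ((ℕ × ℕ) × List Bool) × ℕ => p.1.1.1 + 1 + p.2 :=
      computable_add.comp (computable_add.comp
        (Computable.fst.comp (Computable.fst.comp Computable.fst)) (Computable.const 1))
        Computable.snd
    exact hD.comp h3 (computable_padTo.comp (hN.comp h3) (Computable.snd.comp Computable.fst))
  have hEcyl : ∀ m j, cylSet (Λ (m + 1 + j)) (E (m, j)) =
      ⋃ i < j, cylSet (N (m + 1 + i)) (D (m + 1 + i)) := by
    intro m j
    ext Z
    simp only [cylSet, hE, Set.mem_ofPred_eq, existsLT_eq_true, Set.mem_iUnion, exists_prop]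
    refine exists_congr fun i => and_congr_right fun hi => ?_
    rw [padTo_prefixList (hΛN _ _ (by omega))]
  have hsub : ∀ m j, openCl (S m) ⊆ cylSet (Λ (m + 1 + j)) (E (m, j)) ∪ openCl (S (m + j)) := by
    intro m j Z
    rw [hopen, hEcyl, hopen]
    simp only [Set.mem_iUnion, Set.mem_union, exists_prop]
    rintro ⟨i, hi⟩
    by_cases hij : i < j
    · exact Or.inl ⟨i, hij, hi⟩
    · refine Or.inr ⟨i - j, ?_⟩
      have : m + j + 1 + (i - j) = m + 1 + i := by omega
      rwa [this]
  have hsub' : ∀ m j, cylSet (Λ (m + 1 + j)) (E (m, j)) ⊆ openCl (S m) := by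
    intro m j Z
    rw [hopen, hEcyl]
    simp only [Set.mem_iUnion, exists_prop]
    rintro ⟨i, -, hi⟩
    exact ⟨i, hi⟩
  have htest : SchnorrTest μ S := by
    refine ⟨⟨f, hfc, fun _ => rfl⟩, hbound,
      fun m j => Q (countStrings (Λ (m + 1 + j)) (E (m, j))) (2 ^ Λ (m + 1 + j)), ?_, ?_⟩
    · have h1 : Computable fun p : ℕ × ℕ => Λ (p.1 + 1 + p.2) :=
        hΛ.comp (computable_add.comp (computable_add.comp Computable.fst (Computable.const 1))
          Computable.snd)
      exact hQ.comp (computable_countStrings hEc h1) (computable_pow_two.comp h1)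
    · intro m j
      simp only [hQe _ _ (Nat.two_pow_pos _)]
      push_cast
      rw [← hμ.measureReal_cylSet, abs_le]
      have h1 := measureReal_mono (μ := μ) (hsub' m j)
      have h2 := (measureReal_mono (μ := μ) (hsub m j)).trans (measureReal_union_le _ _)
      have h3 : μ.real (openCl (S (m + j))) ≤ 2⁻¹ ^ j := by
        have := ENNReal.toReal_mono (by simp) (hbound (m + j))
        rw [ENNReal.toReal_pow, ENNReal.toReal_inv, ENNReal.toReal_ofNat] at this
        exact this.trans (pow_le_pow_of_le_one (by norm_num) (by norm_num) (by omega))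
      simp only [Measure.real] at h1 h2 h3
      have h4 : (0 : ℝ) ≤ 2⁻¹ ^ j := by positivity
      constructor <;> linarith
  obtain ⟨m, hm⟩ := hz S htest
  refine ⟨m + 1, fun l hl hzl => hm ?_⟩
  rw [hopen, Set.mem_iUnion]
  refine ⟨l - (m + 1), ?_⟩
  rwa [Nat.add_sub_cancel' hl]

theorem SchnorrRandom.exists_eventually_not_mem_cylSet {μ : Measure (ℕ → Bool)}
    (hμ : IsUniformMeasure μ) {z : ℕ → Bool} (hz : SchnorrRandom μ z) {N : ℕ → ℕ}
    (hN : Computable N) {C : ℕ → ℕ → List Bool → Bool}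
    (hC : Computable fun x : ℕ × ℕ × List Bool => C x.1 x.2.1 x.2.2)
    (hex : ∀ l, ∃ p, μ (cylSet (N p) (C l p)) ≤ 2⁻¹ ^ l) :
    ∃ p : ℕ → ℕ, ∃ l₀, ∀ l ≥ l₀, z ∉ cylSet (N (p l)) (C l (p l)) := by
  have hiff : ∀ l p, μ (cylSet (N p) (C l p)) ≤ 2⁻¹ ^ l ↔
      decide (countStrings (N p) (C l p) * 2 ^ l ≤ 2 ^ N p) = true := by
    intro l p
    rw [hμ.measure_cylSet, decide_eq_true_eq, ← ENNReal.inv_pow, ← ENNReal.inv_pow,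
      ← div_eq_mul_inv, ENNReal.div_le_iff (by simp) (by simp), mul_comm _ ((2 : ENNReal) ^ N p),
      ← div_eq_mul_inv, ENNReal.le_div_iff_mul_le (by simp) (by simp)]
    exact_mod_cast Iff.rfl
  have hC' : Computable₂ fun (x : ℕ × ℕ) σ => C x.1 x.2 σ :=
    hC.comp (Computable.pair (Computable.fst.comp Computable.fst)
      (Computable.pair (Computable.snd.comp Computable.fst) Computable.snd))
  obtain ⟨p, hp, hp'⟩ := exists_computable_search (α := ℕ)
    (φ := fun l p => decide (countStrings (N p) (C l p) * 2 ^ l ≤ 2 ^ N p))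
    (computable_le.comp
      (computable_mul.comp (computable_countStrings hC' (hN.comp Computable.snd))
        (computable_pow_two.comp Computable.fst))
      (computable_pow_two.comp (hN.comp Computable.snd)))
    (fun l => (hex l).imp fun p => (hiff l p).1)
  refine ⟨p, hz.eventually_not_mem_cylSet hμ (hN.comp hp) (D := fun l σ => C l (p l) σ) ?_
    fun l => (hiff l _).2 (hp' l)⟩
  exact hC'.comp (Computable.pair Computable.fst (hp.comp Computable.fst)) Computable.snd

/-- No string enumerated by `g` before stage `t` and of length at most `t` is a prefix of `σ`. -/
def avoidsUpTo (g : ℕ → Option (List Bool)) (t : ℕ) (σ : List Bool) : Bool :=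
  forallLT t fun j => Option.casesOn (g j) true
    fun τ => !(decide (τ.length ≤ t) && decide (padTo τ.length σ = τ))

theorem computable_avoidsUpTo {g : ℕ → Option (List Bool)} (hg : Computable g) :
    Computable₂ (avoidsUpTo g) := by
  refine computable_forallLT (α := ℕ × List Bool)
    (φ := fun p j => Option.casesOn (g j) true
      fun τ => !(decide (τ.length ≤ p.1) && decide (padTo τ.length p.2 = τ))) ?_ Computable.fst
  refine Computable.option_casesOn (hg.comp Computable.snd) (Computable.const true)
    (computable_not.comp (computable_and.comp ?_ ?_))
  · exact computable_le.comp (Computable.list_length.comp Computable.snd)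
      (Computable.fst.comp (Computable.fst.comp Computable.fst))
  · exact computable_beq.comp (computable_padTo.comp (Computable.list_length.comp Computable.snd)
      (Computable.snd.comp (Computable.fst.comp Computable.fst))) Computable.snd

theorem avoidsUpTo_eq_true {g : ℕ → Option (List Bool)} {t : ℕ} {ρ : List Bool} {Y : ℕ → Bool}
    (hρ : IsPrefixOf ρ Y) (ht : t ≤ ρ.length) :
    avoidsUpTo g t ρ = true ↔
      ∀ j < t, ∀ τ, g j = some τ → τ.length ≤ t → ¬ IsPrefixOf τ Y := by
  rw [avoidsUpTo, forallLT_eq_true]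
  refine forall₂_congr fun j _ => ?_
  cases g j with
  | none => simp
  | some τ =>
    simp only [Option.some.injEq, forall_eq', Bool.not_eq_true', Bool.and_eq_false_iff,
      decide_eq_false_iff_not, isPrefixOf_iff]
    by_cases h : τ.length ≤ t
    · rw [hρ.padTo_eq (h.trans ht)]
      simp [h]
    · simp [h]

/-- The stage-`t` clopen approximation from above to the class avoiding the strings in the
range of `g`. -/
def approxClass (g : ℕ → Option (List Bool)) (t : ℕ) : Set (ℕ → Bool) := cylSet t (avoidsUpTo g t)

theorem mem_approxClass {g : ℕ → Option (List Bool)} {t : ℕ} {Y : ℕ → Bool} :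
    Y ∈ approxClass g t ↔ ∀ j < t, ∀ τ, g j = some τ → τ.length ≤ t → ¬ IsPrefixOf τ Y :=
  avoidsUpTo_eq_true (isPrefixOf_prefixList Y t) (length_prefixList _ _).ge

theorem avoidsUpTo_iff_mem {g : ℕ → Option (List Bool)} {t : ℕ} {ρ : List Bool} {Y : ℕ → Bool}
    (hρ : IsPrefixOf ρ Y) (ht : t ≤ ρ.length) :
    avoidsUpTo g t ρ = true ↔ Y ∈ approxClass g t := by
  rw [avoidsUpTo_eq_true hρ ht, mem_approxClass]

theorem measurableSet_approxClass (g : ℕ → Option (List Bool)) (t : ℕ) :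
    MeasurableSet (approxClass g t) := measurableSet_cylSet _ _

theorem antitone_approxClass (g : ℕ → Option (List Bool)) : Antitone (approxClass g) := by
  intro t t' h Y hY
  rw [mem_approxClass] at hY ⊢
  exact fun j hj τ hτ hl => hY j (hj.trans_le h) τ hτ (hl.trans h)

theorem iInter_approxClass (g : ℕ → Option (List Bool)) :
    ⋂ t, approxClass g t = (openCl {σ | ∃ n, g n = some σ})ᶜ := by
  ext Y
  simp only [Set.mem_iInter, mem_approxClass, Set.mem_compl_iff, openCl, Set.mem_ofPred_eq,
    not_exists, not_and]
  constructor
  · rintro h σ ⟨n, hn⟩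
    exact h (n + 1 + σ.length) n (by omega) σ hn (by omega)
  · exact fun h t j _ τ hτ _ => h τ ⟨j, hτ⟩

/-- The monotone string function `f` computes the map `T`. -/
def Computes (f : List Bool → List Bool) (T : (ℕ → Bool) → ℕ → Bool) : Prop :=
  (∀ σ τ : List Bool, σ <+: τ → f σ <+: f τ) ∧ ∀ Z : ℕ → Bool, ∀ m : ℕ, ∃ n : ℕ,
    m ≤ (f (prefixList Z n)).length ∧ IsPrefixOf (f (prefixList Z n)) (T Z)

theorem IsPrefixOf.of_isPrefix {σ τ : List Bool} {Z : ℕ → Bool} (h : IsPrefixOf τ Z)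
    (hστ : σ <+: τ) : IsPrefixOf σ Z := by
  intro i hi
  rw [← h i (hi.trans_le hστ.length_le), List.getD_eq_getElem _ _ hi,
    List.getD_eq_getElem _ _ (hi.trans_le hστ.length_le), hστ.getElem hi]

theorem Computes.isPrefixOf {f : List Bool → List Bool} {T : (ℕ → Bool) → ℕ → Bool}
    (h : Computes f T) (Z : ℕ → Bool) (n : ℕ) : IsPrefixOf (f (prefixList Z n)) (T Z) := by
  obtain ⟨m, hm, hp⟩ := h.2 Z (f (prefixList Z n)).length
  rcases le_total n m with hnm | hnm
  · exact hp.of_isPrefix (h.1 _ _ (prefixList_isPrefix hnm Z))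
  · rwa [← (h.1 _ _ (prefixList_isPrefix hnm Z)).eq_of_length_le hm]

theorem Computes.eventually_le_length {f : List Bool → List Bool} {T : (ℕ → Bool) → ℕ → Bool}
    (h : Computes f T) (Z : ℕ → Bool) (m : ℕ) :
    ∀ᶠ n in Filter.atTop, m ≤ (f (prefixList Z n)).length := by
  obtain ⟨n, hn, -⟩ := h.2 Z m
  filter_upwards [Filter.eventually_ge_atTop n] with n' hn'
  exact hn.trans (h.1 _ _ (prefixList_isPrefix hn' Z)).length_le

theorem Computes.comp {f g : List Bool → List Bool} {T U : (ℕ → Bool) → ℕ → Bool}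
    (hf : Computes f T) (hg : Computes g U) : Computes (f ∘ g) (T ∘ U) := by
  refine ⟨fun σ τ h => hf.1 _ _ (hg.1 _ _ h), fun Z m => ?_⟩
  obtain ⟨n₁, h₁, -⟩ := hf.2 (U Z) m
  obtain ⟨n₂, h₂, h₂'⟩ := hg.2 Z n₁
  refine ⟨n₂, ?_, ?_⟩
  · simp only [Function.comp_apply]
    rw [← (isPrefixOf_iff _ _).1 h₂']
    exact h₁.trans (hf.1 _ _ (prefixList_isPrefix h₂ _)).length_le
  · simp only [Function.comp_apply]
    rw [← (isPrefixOf_iff _ _).1 h₂']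
    exact hf.isPrefixOf _ _

theorem Computes.iterate {f : List Bool → List Bool} {T : (ℕ → Bool) → ℕ → Bool}
    (h : Computes f T) (n : ℕ) : Computes f^[n] T^[n] := by
  induction n with
  | zero => exact ⟨fun _ _ h => h, fun Z m => ⟨m, by simp, isPrefixOf_prefixList _ _⟩⟩
  | succ n ih => exact ih.comp h

theorem exists_measure_cylSet_le {μ : Measure (ℕ → Bool)} [IsProbabilityMeasure μ]
    {φ : ℕ → List Bool → Bool} {E : Set (ℕ → Bool)}
    (h : ∀ Z, ∀ᶠ L in Filter.atTop, Z ∈ cylSet L (φ L) ↔ Z ∈ E) {ε : ENNReal} (hε : μ E < ε) :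
    ∃ L, μ (cylSet L (φ L)) ≤ ε := by
  have ht := tendsto_measure_of_tendsto_indicator_of_isFiniteMeasure Filter.atTop (μ := μ)
    (As := fun L => cylSet L (φ L)) (A := E) (fun L => measurableSet_cylSet _ _) h
  obtain ⟨L, hL⟩ := (ht.eventually_lt_const hε).exists
  exact ⟨L, hL.le⟩

theorem exists_computable_modulus {μ : Measure (ℕ → Bool)} (hμ : IsUniformMeasure μ)
    {g : ℕ → Option (List Bool)} (hg : Computable g)
    (hcomp : ComputableReal (μ (⋂ t, approxClass g t)).toReal) {r : ℕ → ℕ} (hr : Computable r) :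
    ∃ s : ℕ → ℕ, Computable s ∧ ∀ l, l ≤ s l ∧
      μ.real (approxClass g (s l) \ ⋂ t, approxClass g t) ≤ 3 * 2⁻¹ ^ r l := by
  have := hμ.isProbabilityMeasure
  obtain ⟨q, hq, hqe⟩ := hcomp
  set P := ⋂ t, approxClass g t with hP
  have hiff : ∀ l t, (μ.real (approxClass g t) ≤
        ((q (r l)).num.toNat : ℝ) / (q (r l)).den + 2 * 2⁻¹ ^ r l ↔
      decide (countStrings t (avoidsUpTo g t) * ((q (r l)).den * 2 ^ r l) ≤
        ((q (r l)).num.toNat * 2 ^ r l + 2 * (q (r l)).den) * 2 ^ t) = true) := by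
    intro l t
    have h1 := hμ.measureReal_cylSet t (avoidsUpTo g t)
    have hd : (0 : ℝ) < (q (r l)).den := by exact_mod_cast (q (r l)).den_pos
    have hc : ((q (r l)).num.toNat : ℝ) / (q (r l)).den + 2 * 2⁻¹ ^ r l =
        ((q (r l)).num.toNat * 2 ^ r l + 2 * (q (r l)).den) / ((q (r l)).den * 2 ^ r l) := by
      rw [inv_pow]; field_simp
    rw [approxClass, Measure.real, h1, hc, div_le_div_iff₀ (by positivity) (by positivity),
      decide_eq_true_eq]
    exact_mod_cast Iff.rfl
  have hqd : ∀ l, (q (r l) : ℝ) ≤ ((q (r l)).num.toNat : ℝ) / (q (r l)).den := by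
    intro l
    conv_lhs => rw [Rat.cast_def]
    gcongr
    exact_mod_cast Int.self_le_toNat _
  have hqu : ∀ l, ((q (r l)).num.toNat : ℝ) / (q (r l)).den ≤ (μ P).toReal + 2⁻¹ ^ r l := by
    intro l
    have h1 := abs_le.1 (hqe (r l))
    rcases le_total 0 (q (r l)).num with h | h
    · have h2 : ((q (r l)).num.toNat : ℝ) = ((q (r l)).num : ℝ) := by
        exact_mod_cast congrArg (Int.cast : ℤ → ℝ) (Int.toNat_of_nonneg h)
      rw [h2, ← Rat.cast_def]
      linarith
    · rw [Int.toNat_of_nonpos h]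
      simp only [Nat.cast_zero, zero_div]
      positivity
  have hlim : Filter.Tendsto (fun t => μ.real (approxClass g t)) Filter.atTop
      (nhds (μ.real P)) := by
    refine (ENNReal.tendsto_toReal (measure_ne_top _ _)).comp ?_
    exact tendsto_measure_iInter_atTop
      (fun t => (measurableSet_approxClass g t).nullMeasurableSet)
      (antitone_approxClass g) ⟨0, measure_ne_top _ _⟩
  obtain ⟨s, hs, hs'⟩ := exists_computable_search (α := ℕ)
    (φ := fun l t => decide (l ≤ t) &&
      decide (countStrings t (avoidsUpTo g t) * ((q (r l)).den * 2 ^ r l) ≤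
        ((q (r l)).num.toNat * 2 ^ r l + 2 * (q (r l)).den) * 2 ^ t))
    (by
      have h1 := computable_rat_den.comp (hq.comp (hr.comp (Computable.fst (α := ℕ) (β := ℕ))))
      have h2 := computable_rat_num_toNat.comp
        (hq.comp (hr.comp (Computable.fst (α := ℕ) (β := ℕ))))
      have h3 := computable_pow_two.comp (hr.comp (Computable.fst (α := ℕ) (β := ℕ)))
      have h4 : Computable fun p : ℕ × ℕ => countStrings p.2 (avoidsUpTo g p.2) :=
        computable_countStrings (φ := fun (p : ℕ × ℕ) => avoidsUpTo g p.2)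
          ((computable_avoidsUpTo hg).comp (Computable.snd.comp Computable.fst) Computable.snd)
          Computable.snd
      exact computable_and.comp (computable_le.comp Computable.fst Computable.snd)
        (computable_le.comp (computable_mul.comp h4 (computable_mul.comp h1 h3))
          (computable_mul.comp (computable_add.comp (computable_mul.comp h2 h3)
            (computable_mul.comp (Computable.const 2) h1))
            (computable_pow_two.comp Computable.snd))))
    (by
      intro l
      have h1 : μ.real P < (q (r l)).num.toNat / (q (r l)).den + 2 * 2⁻¹ ^ r l := by
        have h1 := (abs_le.1 (hqe (r l))).2
        have h2 := hqd l
        have h3 : (0 : ℝ) < 2⁻¹ ^ r l := by positivity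
        rw [Measure.real]
        linarith
      obtain ⟨t, ht, ht'⟩ := ((hlim.eventually_lt_const h1).and
        (Filter.eventually_ge_atTop l)).exists
      refine ⟨t, ?_⟩
      rw [Bool.and_eq_true, ← hiff]
      exact ⟨by simpa using ht', ht.le⟩)
  refine ⟨s, hs, fun l => ?_⟩
  have h := hs' l
  rw [Bool.and_eq_true, ← hiff, decide_eq_true_eq] at h
  refine ⟨h.1, ?_⟩
  rw [measureReal_sdiff (Set.iInter_subset _ _)
    (MeasurableSet.iInter fun t => measurableSet_approxClass g t)]
  have h2 := hqu l
  have h3 := h.2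
  rw [← hP, Measure.real, Measure.real] at *
  linarith

theorem eventually_forall_le_length {k : ℕ} {F : ℕ → List Bool → List Bool}
    {T : Fin k → (ℕ → Bool) → ℕ → Bool} (hF : ∀ i : Fin k, Computes (F i) (T i))
    (Z : ℕ → Bool) (M b : ℕ) :
    ∀ᶠ L in Filter.atTop, ∀ n < M, ∀ i : Fin k, b ≤ ((F i)^[n] (prefixList Z L)).length := by
  have h1 : ∀ n : Fin M, ∀ i : Fin k, ∀ᶠ L in Filter.atTop,
      b ≤ ((F i)^[(n : ℕ)] (prefixList Z L)).length :=
    fun n i => ((hF i).iterate n).eventually_le_length Z b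
  have h2 := Filter.eventually_all.2 fun n => Filter.eventually_all.2 (h1 n)
  filter_upwards [h2] with L hL n hn i using hL ⟨n, hn⟩ i

theorem three_mul_inv_two_pow_lt (a l : ℕ) (m : ℝ) (hm : m ≤ 3 * 2⁻¹ ^ (3 * a + l)) :
    a * m < 2⁻¹ ^ l := by
  have h : ((3 * a : ℕ) : ℝ) < 2 ^ (3 * a) := by exact_mod_cast Nat.lt_two_pow_self
  push_cast at h
  calc a * m ≤ a * (3 * 2⁻¹ ^ (3 * a + l)) := by gcongr
    _ = (3 * a) * (2⁻¹ ^ (3 * a)) * 2⁻¹ ^ l := by rw [pow_add]; ring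
    _ < 1 * 2⁻¹ ^ l := by
      have : (3 * a : ℝ) * 2⁻¹ ^ (3 * a) < 1 := by
        rw [inv_pow, ← div_eq_mul_inv, div_lt_one (by positivity)]
        exact h
      gcongr
    _ = 2⁻¹ ^ l := one_mul _

section

variable {μ : Measure (ℕ → Bool)} {k : ℕ} {T : Fin k → (ℕ → Bool) → ℕ → Bool}
  {g : ℕ → Option (List Bool)} {F : ℕ → List Bool → List Bool} {z : ℕ → Bool} {t : ℕ → ℕ}

theorem SchnorrRandom.eventually_orbit_mem (hμ : IsUniformMeasure μ)
    (hT : ∀ i, MeasurePreserving (T i) μ μ) (hg : Computable g) (hFc : Computable₂ F)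
    (hF : ∀ i : Fin k, Computes (F i) (T i)) (ht : Computable t) (htl : ∀ l, l ≤ t l)
    (htm : ∀ l, μ.real (approxClass g (t l) \ ⋂ s, approxClass g s) ≤
      3 * 2⁻¹ ^ (3 * ((l + 1) * k) + l))
    (hz : SchnorrRandom μ z) :
    ∃ l₀, ∀ l ≥ l₀, ∀ n ≤ l, ∀ i, (T i)^[n] z ∈ approxClass g (t l) →
      (T i)^[n] z ∈ ⋂ s, approxClass g s := by
  have := hμ.isProbabilityMeasure
  let B : ℕ → ℕ → ℕ → List Bool → Bool := fun l n i σ =>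
    decide (t l + t (l + 1) ≤ ((F i)^[n] σ).length) &&
      (!avoidsUpTo g (t l) ((F i)^[n] σ) || avoidsUpTo g (t (l + 1)) ((F i)^[n] σ))
  let C : ℕ → ℕ → List Bool → Bool := fun l _ σ =>
    !(forallLT (l + 1) fun n => forallLT k fun i => B l n i σ)
  have hB : ∀ l n (i : Fin k) Z L, B l n i (prefixList Z L) = true →
      (T i)^[n] Z ∉ approxClass g (t l) \ approxClass g (t (l + 1)) := by
    intro l n i Z L h
    simp only [B, Bool.and_eq_true, decide_eq_true_eq, Bool.or_eq_true, Bool.not_eq_true'] at h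
    have hp := ((hF i).iterate n).isPrefixOf Z L
    rintro ⟨h1, h2⟩
    rcases h.2 with h' | h'
    · rw [← avoidsUpTo_iff_mem hp (by omega), h'] at h1
      exact absurd h1 (by simp)
    · exact h2 ((avoidsUpTo_iff_mem hp (by omega)).1 h')
  have hB' : ∀ l n (i : Fin k) Z L, t l + t (l + 1) ≤ ((F i)^[n] (prefixList Z L)).length →
      (T i)^[n] Z ∉ approxClass g (t l) \ approxClass g (t (l + 1)) →
      B l n i (prefixList Z L) = true := by
    intro l n i Z L hlen h
    have hp := ((hF i).iterate n).isPrefixOf Z L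
    simp only [B, Bool.and_eq_true, decide_eq_true_eq, Bool.or_eq_true, Bool.not_eq_true', hlen,
      true_and]
    rw [← Bool.not_eq_true, avoidsUpTo_iff_mem hp (by omega), avoidsUpTo_iff_mem hp (by omega)]
    by_contra! hcon
    exact h hcon
  have hCc : Computable fun x : ℕ × ℕ × List Bool => C x.1 x.2.1 x.2.2 := by
    refine computable_not.comp (computable_forallLT
      (φ := fun (x : ℕ × ℕ × List Bool) n => forallLT k fun i => B x.1 n i x.2.2) ?_
      (computable_add.comp Computable.fst (Computable.const 1)))
    refine computable_forallLT (α := (ℕ × ℕ × List Bool) × ℕ)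
      (φ := fun y i => B y.1.1 y.2 i y.1.2.2) ?_ (Computable.const k)
    have hl : Computable fun y : ((ℕ × ℕ × List Bool) × ℕ) × ℕ => t y.1.1.1 :=
      ht.comp (Computable.fst.comp (Computable.fst.comp Computable.fst))
    have hl' : Computable fun y : ((ℕ × ℕ × List Bool) × ℕ) × ℕ => t (y.1.1.1 + 1) :=
      ht.comp (computable_add.comp (Computable.fst.comp (Computable.fst.comp Computable.fst))
        (Computable.const 1))
    have hρ : Computable fun y : ((ℕ × ℕ × List Bool) × ℕ) × ℕ => (F y.2)^[y.1.2] y.1.1.2.2 :=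
      computable_iterate hFc Computable.snd (Computable.snd.comp Computable.fst)
        (Computable.snd.comp (Computable.snd.comp (Computable.fst.comp Computable.fst)))
    have h1 : Computable fun y : ((ℕ × ℕ × List Bool) × ℕ) × ℕ =>
        decide (t y.1.1.1 + t (y.1.1.1 + 1) ≤ ((F y.2)^[y.1.2] y.1.1.2.2).length) :=
      computable_le.comp (computable_add.comp hl hl') (Computable.list_length.comp hρ)
    have h2 : Computable fun y : ((ℕ × ℕ × List Bool) × ℕ) × ℕ =>
        !avoidsUpTo g (t y.1.1.1) ((F y.2)^[y.1.2] y.1.1.2.2) :=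
      computable_not.comp ((computable_avoidsUpTo hg).comp hl hρ)
    have h3 : Computable fun y : ((ℕ × ℕ × List Bool) × ℕ) × ℕ =>
        avoidsUpTo g (t (y.1.1.1 + 1)) ((F y.2)^[y.1.2] y.1.1.2.2) :=
      (computable_avoidsUpTo hg).comp hl' hρ
    exact computable_and.comp h1 (computable_or.comp h2 h3)
  have hex : ∀ l, ∃ p, μ (cylSet p (C l p)) ≤ 2⁻¹ ^ l := by
    intro l
    set D := approxClass g (t l) \ approxClass g (t (l + 1)) with hD
    have hDm : MeasurableSet D :=
      (measurableSet_approxClass _ _).diff (measurableSet_approxClass _ _)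
    refine exists_measure_cylSet_le
      (E := ⋃ p ∈ (Finset.range (l + 1) ×ˢ Finset.univ : Finset (ℕ × Fin k)), (T p.2)^[p.1] ⁻¹' D)
      (fun Z => ?_) ?_
    · filter_upwards [eventually_forall_le_length hF Z (l + 1) (t l + t (l + 1))] with L hL
      simp only [cylSet, Set.mem_ofPred_eq, C, Bool.not_eq_true', Set.mem_iUnion,
        Finset.mem_product, Finset.mem_range, Finset.mem_univ, and_true, Set.mem_preimage,
        exists_prop, Prod.exists]
      rw [← Bool.not_eq_true, ← not_iff_not, not_not, forallLT_eq_true]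
      simp only [forallLT_eq_true, not_exists, not_and]
      constructor
      · exact fun h n i hn => hB l n i Z L (h n hn i i.2)
      · exact fun h n hn i hi => hB' l n ⟨i, hi⟩ Z L (hL n hn ⟨i, hi⟩) (h n ⟨i, hi⟩ hn)
    · refine (measure_biUnion_finset_le _ _).trans_lt ?_
      have h1 : ∀ p ∈ (Finset.range (l + 1) ×ˢ Finset.univ : Finset (ℕ × Fin k)),
          μ ((T p.2)^[p.1] ⁻¹' D) = μ D := fun p _ =>
        ((hT p.2).iterate p.1).measure_preimage hDm.nullMeasurableSet
      rw [Finset.sum_congr rfl h1, Finset.sum_const, Finset.card_product, Finset.card_range,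
        Finset.card_univ, Fintype.card_fin, nsmul_eq_mul]
      rw [← ENNReal.toReal_lt_toReal (ENNReal.mul_ne_top (ENNReal.natCast_ne_top _) (measure_ne_top _ _))
        (by simp)]
      simp only [ENNReal.toReal_mul, ENNReal.toReal_natCast, ENNReal.toReal_pow,
        ENNReal.toReal_inv, ENNReal.toReal_ofNat]
      refine three_mul_inv_two_pow_lt _ l _ (le_trans ?_ (htm l))
      exact measureReal_mono (Set.sdiff_subset_sdiff_right (Set.iInter_subset _ _))
  obtain ⟨p, l₀, h⟩ := hz.exists_eventually_not_mem_cylSet hμ Computable.id hCc hex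
  have hstep : ∀ l ≥ l₀, ∀ n ≤ l, ∀ i, (T i)^[n] z ∈ approxClass g (t l) →
      (T i)^[n] z ∈ approxClass g (t (l + 1)) := by
    intro l hl n hn i hm
    have h1 := h l hl
    simp only [cylSet, Set.mem_ofPred_eq, C, Bool.not_eq_true', Bool.not_eq_false,
      forallLT_eq_true] at h1
    have h2 := hB l n i z _ (h1 n (by omega) i i.2)
    by_contra hcon
    exact h2 ⟨hm, hcon⟩
  refine ⟨l₀, fun l hl n hn i hm => Set.mem_iInter.2 fun s => ?_⟩
  have h3 : ∀ d, (T i)^[n] z ∈ approxClass g (t (l + d)) := by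
    intro d
    induction d with
    | zero => exact hm
    | succ d ih => exact hstep (l + d) (by omega) n (by omega) i ih
  exact antitone_approxClass g (by have := htl (l + s); omega) (h3 s)

theorem SchnorrRandom.eventually_exists_return (hμ : IsUniformMeasure μ)
    (hT : ∀ i, MeasurePreserving (T i) μ μ) (hcomm : ∀ i j, T i ∘ T j = T j ∘ T i)
    (hg : Computable g) (hFc : Computable₂ F)
    (hF : ∀ i : Fin k, Computes (F i) (T i)) (ht : Computable t) (htl : ∀ l, l ≤ t l)
    (hz : SchnorrRandom μ z) (hzP : z ∈ ⋂ s, approxClass g s) :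
    ∃ j₀, ∀ j ≥ j₀, ∃ N ≥ j, ∃ n, 1 ≤ n ∧ n ≤ N ∧ ∀ i, (T i)^[n] z ∈ approxClass g (t N) := by
  have := hμ.isProbabilityMeasure
  set P := ⋂ s, approxClass g s with hP
  have hPm : MeasurableSet P := MeasurableSet.iInter fun s => measurableSet_approxClass g s
  let B : ℕ → ℕ → ℕ → List Bool → Bool := fun N n i σ =>
    decide (t N ≤ ((F i)^[n] σ).length) && avoidsUpTo g (t N) ((F i)^[n] σ)
  have hB : ∀ N n (i : Fin k) Z L, B N n i (prefixList Z L) = true →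
      (T i)^[n] Z ∈ approxClass g (t N) := by
    intro N n i Z L h
    simp only [B, Bool.and_eq_true, decide_eq_true_eq] at h
    exact (avoidsUpTo_iff_mem (((hF i).iterate n).isPrefixOf Z L) h.1).1 h.2
  have hB' : ∀ N n (i : Fin k) Z L, t N ≤ ((F i)^[n] (prefixList Z L)).length →
      (T i)^[n] Z ∈ approxClass g (t N) → B N n i (prefixList Z L) = true := by
    intro N n i Z L hlen h
    simp only [B, Bool.and_eq_true, decide_eq_true_eq]
    exact ⟨hlen, (avoidsUpTo_iff_mem (((hF i).iterate n).isPrefixOf Z L) hlen).2 h⟩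
  let R : ℕ → List Bool → Bool := fun N σ =>
    !(decide (t N ≤ σ.length) && !avoidsUpTo g (t N) σ) &&
      !(existsLT N fun n => forallLT k fun i => B N (n + 1) i σ)
  let C : ℕ → ℕ → List Bool → Bool := fun j p σ => R (j + p.unpair.1) σ
  have hRc : Computable₂ R := by
    have hl : Computable fun y : ℕ × List Bool => t y.1 := ht.comp Computable.fst
    refine computable_and.comp (computable_not.comp (computable_and.comp
      (computable_le.comp hl (Computable.list_length.comp Computable.snd))
      (computable_not.comp ((computable_avoidsUpTo hg).comp hl Computable.snd))))
      (computable_not.comp (computable_existsLT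
        (φ := fun (y : ℕ × List Bool) n => forallLT k fun i => B y.1 (n + 1) i y.2) ?_
        Computable.fst))
    refine computable_forallLT (α := (ℕ × List Bool) × ℕ)
      (φ := fun y i => B y.1.1 (y.2 + 1) i y.1.2) ?_ (Computable.const k)
    have hl : Computable fun y : ((ℕ × List Bool) × ℕ) × ℕ => t y.1.1.1 :=
      ht.comp (Computable.fst.comp (Computable.fst.comp Computable.fst))
    have hρ : Computable fun y : ((ℕ × List Bool) × ℕ) × ℕ => (F y.2)^[y.1.2 + 1] y.1.1.2 :=
      computable_iterate hFc Computable.snd (computable_add.comp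
        (Computable.snd.comp Computable.fst) (Computable.const 1))
        (Computable.snd.comp (Computable.fst.comp Computable.fst))
    have h1 : Computable fun y : ((ℕ × List Bool) × ℕ) × ℕ =>
        decide (t y.1.1.1 ≤ ((F y.2)^[y.1.2 + 1] y.1.1.2).length) :=
      computable_le.comp hl (Computable.list_length.comp hρ)
    have h2 : Computable fun y : ((ℕ × List Bool) × ℕ) × ℕ =>
        avoidsUpTo g (t y.1.1.1) ((F y.2)^[y.1.2 + 1] y.1.1.2) :=
      (computable_avoidsUpTo hg).comp hl hρ
    exact computable_and.comp h1 h2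
  have hCc : Computable fun x : ℕ × ℕ × List Bool => C x.1 x.2.1 x.2.2 :=
    hRc.comp (computable_add.comp Computable.fst (Computable.fst.comp (Computable.unpair.comp
      (Computable.fst.comp Computable.snd)))) (Computable.snd.comp Computable.snd)
  have hRP : ∀ N, ∀ ε, μ {Z | Z ∈ approxClass g (t N) ∧
      ∀ n < N, ∃ i, (T i)^[n + 1] Z ∉ approxClass g (t N)} < ε →
      ∃ L, μ (cylSet L (R N)) ≤ ε := by
    intro N ε hε
    refine exists_measure_cylSet_le (fun Z => ?_) hε
    filter_upwards [eventually_forall_le_length hF Z (N + 1) (t N),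
      Filter.eventually_ge_atTop (t N)] with L hL hL'
    simp only [cylSet, Set.mem_ofPred_eq, R, Bool.and_eq_true, Bool.not_eq_true',
      length_prefixList, hL', decide_true, Bool.true_and, Bool.not_eq_false']
    refine and_congr
      (avoidsUpTo_iff_mem (isPrefixOf_prefixList Z L) (by simpa using hL')) ?_
    rw [← Bool.not_eq_true, existsLT_eq_true]
    push Not
    refine forall₂_congr fun n hn => ?_
    rw [← not_iff_not, not_not, forallLT_eq_true]
    push Not
    constructor
    · exact fun h i => hB N _ i Z L (h i i.2)
    · exact fun h i hi => hB' N _ ⟨i, hi⟩ Z L (hL _ (by omega) ⟨i, hi⟩) (h ⟨i, hi⟩)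
  have hlim : Filter.Tendsto (fun N => μ ((approxClass g (t N) \ P) ∪
      {Z | Z ∈ P ∧ ∀ n < N, ∃ i, (T i)^[n + 1] Z ∉ P})) Filter.atTop (nhds 0) := by
    have h0 : μ {Z | Z ∈ P ∧ ∀ n : ℕ, 1 ≤ n → ∃ i, (T i)^[n] Z ∉ P} = 0 :=
      measure_nonreturning_eq_zero hT hcomm hPm
    rw [← h0]
    refine tendsto_measure_of_tendsto_indicator_of_isFiniteMeasure Filter.atTop _ (fun N => ?_)
      fun Z => ?_
    · refine ((measurableSet_approxClass _ _).diff hPm).union (hPm.inter ?_)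
      have : {Z : ℕ → Bool | ∀ n < N, ∃ i, (T i)^[n + 1] Z ∉ P} =
          ⋂ n, ⋂ (_ : n < N), ⋃ i, ((T i)^[n + 1] ⁻¹' P)ᶜ := by
        ext Z; simp
      change MeasurableSet {Z : ℕ → Bool | ∀ n < N, ∃ i, (T i)^[n + 1] Z ∉ P}
      rw [this]
      exact MeasurableSet.iInter fun n => MeasurableSet.iInter fun _ => MeasurableSet.iUnion
        fun i => (((hT i).iterate (n + 1)).measurable hPm).compl
    · by_cases hZ : Z ∈ P
      · simp only [Set.mem_union, Set.mem_sdiff, hZ, not_true_eq_false, and_false, false_or,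
          Set.mem_ofPred_eq, true_and]
        by_cases hn : ∃ n : ℕ, ∀ i, (T i)^[n + 1] Z ∈ P
        · obtain ⟨n, hn⟩ := hn
          filter_upwards [Filter.eventually_gt_atTop n] with N hN
          constructor
          · intro h
            obtain ⟨i, hi⟩ := h n hN
            exact absurd (hn i) hi
          · intro h
            obtain ⟨i, hi⟩ := h (n + 1) (by omega)
            exact absurd (hn i) hi
        · push Not at hn
          refine Filter.Eventually.of_forall fun N => ⟨fun _ n h1 => ?_, fun _ n _ => hn n⟩
          obtain ⟨n, rfl⟩ := Nat.exists_eq_add_of_le' h1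
          exact hn n
      · have hZ' := hZ
        rw [hP, Set.mem_iInter] at hZ'
        push Not at hZ'
        obtain ⟨s, hs⟩ := hZ'
        filter_upwards [Filter.eventually_ge_atTop s] with N hN
        have : Z ∉ approxClass g (t N) := fun h =>
          hs (antitone_approxClass g (hN.trans (htl N)) h)
        simp [this, hZ]
  have hex : ∀ j, ∃ p, μ (cylSet p.unpair.2 (C j p)) ≤ 2⁻¹ ^ j := by
    intro j
    have hpos : (0 : ENNReal) < 2⁻¹ ^ j := by
      exact pos_iff_ne_zero.2 (pow_ne_zero _ (by simp))
    obtain ⟨N, hN, hjN⟩ := ((hlim.eventually_lt_const hpos).and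
      (Filter.eventually_ge_atTop j)).exists
    have hlt : μ {Z | Z ∈ approxClass g (t N) ∧
        ∀ n < N, ∃ i, (T i)^[n + 1] Z ∉ approxClass g (t N)} < 2⁻¹ ^ j := by
      refine lt_of_le_of_lt (measure_mono ?_) hN
      rintro Z ⟨h1, h2⟩
      by_cases hZ : Z ∈ P
      · exact Or.inr ⟨hZ, fun n hn => (h2 n hn).imp fun i hi hi' => hi (Set.mem_iInter.1 hi' _)⟩
      · exact Or.inl ⟨h1, hZ⟩
    obtain ⟨L, hL⟩ := hRP N _ hlt
    refine ⟨Nat.pair (N - j) L, ?_⟩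
    simp only [C, Nat.unpair_pair, Nat.add_sub_cancel' hjN]
    exact hL
  obtain ⟨p, j₀, h⟩ := hz.exists_eventually_not_mem_cylSet hμ
    (Computable.snd.comp Computable.unpair) hCc hex
  refine ⟨j₀, fun j hj => ⟨j + (p j).unpair.1, Nat.le_add_right _ _, ?_⟩⟩
  have h1 := h j hj
  simp only [cylSet, Set.mem_ofPred_eq, C, R, Bool.and_eq_false_iff, Bool.not_eq_false',
    Bool.and_eq_true, Bool.not_eq_true', decide_eq_false_iff_not] at h1
  have h2 : existsLT (j + (p j).unpair.1) (fun n => forallLT k fun i =>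
      B (j + (p j).unpair.1) (n + 1) i (prefixList z (p j).unpair.2)) = true := by
    rw [← Bool.not_eq_false]
    refine fun h3 => h1 ⟨?_, h3⟩
    refine or_iff_not_imp_left.2 fun h4 => ?_
    rw [avoidsUpTo_iff_mem (isPrefixOf_prefixList _ _) (not_not.1 h4)]
    exact Set.mem_iInter.1 hzP _
  rw [existsLT_eq_true] at h2
  obtain ⟨n, hn, h2⟩ := h2
  rw [forallLT_eq_true] at h2
  exact ⟨n + 1, by omega, by omega, fun i => hB _ _ i z _ (h2 i i.2)⟩

end

/-- For pairwise commuting computable measure-preserving transformations of Cantor space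
and a Π⁰₁ class `P` of positive computable uniform measure, every Schnorr random `z ∈ P`
satisfies `z ∈ ⋂ i, (T i)^{-n} P` for some `n ≥ 1`. -/
theorem schnorrRandom_multiple_recurrence_computableMaps (μ : Measure (ℕ → Bool))
    (hμ : IsUniformMeasure μ)
    (k : ℕ) (hk : 1 ≤ k) (T : Fin k → (ℕ → Bool) → (ℕ → Bool))
    (hTcomp : ∀ i, ComputableMap (T i))
    (hTmeas : ∀ i, Measurable (T i))
    (hTpres : ∀ i, ∀ A : Set (ℕ → Bool), MeasurableSet A → μ (T i ⁻¹' A) = μ A)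
    (hTcomm : ∀ i j, T i ∘ T j = T j ∘ T i)
    (P : Set (ℕ → Bool)) (hP : Pi01Class P) (hPpos : 0 < μ P)
    (hPcomp : ComputableReal (μ P).toReal)
    (z : ℕ → Bool) (hzP : z ∈ P) (hz : SchnorrRandom μ z) :
    ∃ n : ℕ, 1 ≤ n ∧ z ∈ ⋂ i : Fin k, (T i)^[n] ⁻¹' P := by
  obtain ⟨S, ⟨g, hg, rfl⟩, rfl⟩ := hP
  rw [← iInter_approxClass] at hPcomp hzP ⊢
  choose f hf hf' using hTcomp
  obtain ⟨F, hFc, hFf⟩ := exists_computable₂_of_fin k f hf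
  have hF : ∀ i : Fin k, Computes (F i) (T i) := fun i => by rw [hFf]; exact hf' i
  have hT : ∀ i, MeasurePreserving (T i) μ μ := fun i =>
    ⟨hTmeas i, Measure.ext fun A hA => by rw [Measure.map_apply (hTmeas i) hA, hTpres i A hA]⟩
  obtain ⟨t, ht, htl⟩ := exists_computable_modulus hμ hg hPcomp
    (r := fun l => 3 * ((l + 1) * k) + l)
    (computable_add.comp (computable_mul.comp (Computable.const 3) (computable_mul.comp
      (computable_add.comp Computable.id (Computable.const 1)) (Computable.const k)))
      Computable.id)
  obtain ⟨l₀, hl₀⟩ := hz.eventually_orbit_mem hμ hT hg hFc hF ht (fun l => (htl l).1)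
    fun l => (htl l).2
  obtain ⟨j₀, hj₀⟩ := hz.eventually_exists_return hμ hT hTcomm hg hFc hF ht
    (fun l => (htl l).1) hzP
  obtain ⟨N, hN, n, hn, hnN, h⟩ := hj₀ (max j₀ l₀) (le_max_left _ _)
  refine ⟨n, hn, Set.mem_iInter.2 fun i => ?_⟩
  exact hl₀ N ((le_max_right _ _).trans hN) n hnN i (h i)
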